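/- arXiv:1503.02798 — 2 statements merged into one kernel-verified Lean document; each statement's English description precedes it below -/
import Mathlib

section
/- Let p and q be distinct odd primes. Then Z(pq) ≡ 2(2-q)(1 - 1/q³)·B_{p-3} (mod p), as a congruence of rational numbers whose denominators are coprime to p. -/
open Finset

/-- `x ≡ y (mod N)` for rationals: the denominator of `x - y` is coprime to `N`
and `N` divides the numerator of `x - y`. -/
def ratCong (N : ℕ) (x y : ℚ) : Prop :=
  Nat.Coprime (x - y).den N ∧ (N : ℤ) ∣ (x - y).num

/-- `Z n = ∑_{i+j+k=n, i,j,k coprime to n} 1/(ijk)` over ordered triples of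
positive integers. -/
def Z (n : ℕ) : ℚ :=
  ∑ i ∈ Finset.Icc 1 n, ∑ j ∈ Finset.Icc 1 n, ∑ k ∈ Finset.Icc 1 n,
    if i + j + k = n ∧ Nat.Coprime i n ∧ Nat.Coprime j n ∧ Nat.Coprime k n then
      1 / ((i : ℚ) * j * k)
    else 0

/-- The rational number `x` is `p`-integral and its residue in `ZMod p` is `a`. -/
def ReducesTo (p : ℕ) (x : ℚ) (a : ZMod p) : Prop :=
  ∃ u d : ℤ, (d : ZMod p) ≠ 0 ∧ x * d = u ∧ a * d = u

namespace ReducesTo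

variable {p : ℕ}

lemma intCast [Fact p.Prime] (n : ℤ) : ReducesTo p n n :=
  ⟨n, 1, by simp, by simp, by simp⟩

lemma natCast [Fact p.Prime] (n : ℕ) : ReducesTo p n n := by
  simpa using intCast (p := p) n

lemma one [Fact p.Prime] : ReducesTo p 1 1 := by
  simpa using natCast (p := p) 1

lemma add [Fact p.Prime] {x y : ℚ} {a b : ZMod p} (hx : ReducesTo p x a)
    (hy : ReducesTo p y b) : ReducesTo p (x + y) (a + b) := by
  obtain ⟨u, d, hd, h1, h2⟩ := hx
  obtain ⟨v, e, he, h3, h4⟩ := hy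
  refine ⟨u * e + v * d, d * e, by push_cast; exact mul_ne_zero hd he, ?_, ?_⟩
  · push_cast; rw [← h1, ← h3]; ring
  · push_cast; rw [← h2, ← h4]; ring

lemma mul [Fact p.Prime] {x y : ℚ} {a b : ZMod p} (hx : ReducesTo p x a)
    (hy : ReducesTo p y b) : ReducesTo p (x * y) (a * b) := by
  obtain ⟨u, d, hd, h1, h2⟩ := hx
  obtain ⟨v, e, he, h3, h4⟩ := hy
  refine ⟨u * v, d * e, by push_cast; exact mul_ne_zero hd he, ?_, ?_⟩
  · push_cast; rw [← h1, ← h3]; ring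
  · push_cast; rw [← h2, ← h4]; ring

lemma neg [Fact p.Prime] {x : ℚ} {a : ZMod p} (hx : ReducesTo p x a) :
    ReducesTo p (-x) (-a) := by
  simpa using (intCast (p := p) (-1)).mul hx

lemma sub [Fact p.Prime] {x y : ℚ} {a b : ZMod p} (hx : ReducesTo p x a)
    (hy : ReducesTo p y b) : ReducesTo p (x - y) (a - b) := by
  simpa [sub_eq_add_neg] using hx.add hy.neg

lemma pow [Fact p.Prime] {x : ℚ} {a : ZMod p} (hx : ReducesTo p x a) (n : ℕ) :
    ReducesTo p (x ^ n) (a ^ n) := by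
  induction n with
  | zero => simpa using one
  | succ n ih => simpa [pow_succ] using ih.mul hx

lemma inv [Fact p.Prime] {x : ℚ} {a : ZMod p} (hx : ReducesTo p x a) (ha : a ≠ 0) :
    ReducesTo p x⁻¹ a⁻¹ := by
  obtain ⟨u, d, hd, h1, h2⟩ := hx
  have hu : (u : ZMod p) ≠ 0 := h2 ▸ mul_ne_zero ha hd
  have hx0 : x ≠ 0 := by
    rintro rfl
    apply hu
    rw [zero_mul] at h1
    rw [show u = 0 by exact_mod_cast h1.symm, Int.cast_zero]
  refine ⟨d, u, hu, ?_, ?_⟩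
  · rw [← h1]; field_simp
  · rw [← h2]; field_simp

lemma div [Fact p.Prime] {x y : ℚ} {a b : ZMod p} (hx : ReducesTo p x a)
    (hy : ReducesTo p y b) (hb : b ≠ 0) : ReducesTo p (x / y) (a / b) := by
  simpa [div_eq_mul_inv] using hx.mul (hy.inv hb)

lemma sum [Fact p.Prime] {ι : Type*} {s : Finset ι} {f : ι → ℚ} {g : ι → ZMod p}
    (h : ∀ i ∈ s, ReducesTo p (f i) (g i)) : ReducesTo p (∑ i ∈ s, f i) (∑ i ∈ s, g i) := by
  classical
  induction s using Finset.induction_on with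
  | empty => simpa using natCast (p := p) 0
  | insert i s hi ih =>
    rw [Finset.sum_insert hi, Finset.sum_insert hi]
    exact (h i (mem_insert_self i s)).add (ih fun j hj => h j (mem_insert_of_mem hj))

lemma ratCong_zero [Fact p.Prime] {x : ℚ} (hx : ReducesTo p x 0) :
    Nat.Coprime x.den p ∧ (p : ℤ) ∣ x.num := by
  have hp : p.Prime := Fact.out
  obtain ⟨u, d, hd, h1, h2⟩ := hx
  rw [zero_mul] at h2
  have hu : (p : ℤ) ∣ u := (ZMod.intCast_zmod_eq_zero_iff_dvd u p).1 h2.symm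
  have hd' : ¬ (p : ℤ) ∣ d := fun h => hd ((ZMod.intCast_zmod_eq_zero_iff_dvd d p).2 h)
  have key : x.num * d = u * x.den := by
    have hx : (x.den : ℚ) ≠ 0 := by exact_mod_cast x.den_nz
    have : (x.num : ℚ) * d = u * x.den := by
      rw [← h1]; nth_rewrite 2 [← Rat.num_div_den x]; field_simp
    exact_mod_cast this
  have hnum : (p : ℤ) ∣ x.num :=
    ((Nat.prime_iff_prime_int.1 hp).dvd_or_dvd (key ▸ hu.mul_right _)).resolve_right hd'
  refine ⟨?_, hnum⟩
  rw [Nat.coprime_comm, hp.coprime_iff_not_dvd]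
  intro hden
  have h3 : p ∣ x.num.natAbs := Int.natCast_dvd.1 hnum
  exact Nat.Prime.one_lt hp |>.ne' (Nat.dvd_one.1 (x.reduced ▸ Nat.dvd_gcd h3 hden))

lemma ratCong [Fact p.Prime] {x y : ℚ} {a : ZMod p} (hx : ReducesTo p x a)
    (hy : ReducesTo p y a) : ratCong p x y :=
  ratCong_zero (by simpa using hx.sub hy)

lemma unique [Fact p.Prime] {x : ℚ} {a b : ZMod p} (ha : ReducesTo p x a)
    (hb : ReducesTo p x b) : a = b := by
  have h := ha.sub hb
  rw [sub_self] at h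
  obtain ⟨u, d, hd, h1, h2⟩ := h
  rw [zero_mul] at h1
  rw [show u = 0 by exact_mod_cast h1.symm, Int.cast_zero] at h2
  exact sub_eq_zero.1 ((mul_eq_zero.1 h2).resolve_right hd)

end ReducesTo

lemma ZMod.natCast_ne_zero_of_pos_of_lt {p n : ℕ} (h0 : 0 < n) (hn : n < p) :
    (n : ZMod p) ≠ 0 := fun h =>
  absurd (Nat.le_of_dvd h0 ((ZMod.natCast_eq_zero_iff n p).1 h)) (not_le.2 hn)

/-- The Bernoulli numbers `B_i` with `i ≤ p - 2` are `p`-integral. -/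
lemma exists_bernoulli_reducesTo (p : ℕ) [Fact p.Prime] :
    ∃ b : ℕ → ZMod p, ∀ i, i + 1 < p → ReducesTo p (bernoulli i) (b i) := by
  have key : ∀ i, i + 1 < p → ∃ a, ReducesTo p (bernoulli' i) a := by
    intro i
    induction i using Nat.strong_induction_on with
    | _ n ih =>
      intro hn
      choose! c hc using ih
      rw [bernoulli'_def]
      refine ⟨1 - ∑ k ∈ range n, (n.choose k : ZMod p) / ((n - k + 1 : ℕ) : ZMod p) * c k,
        ReducesTo.one.sub (ReducesTo.sum fun k hk => ?_)⟩
      have hk' := mem_range.1 hk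
      have : (n - k + 1 : ℚ) = ((n - k + 1 : ℕ) : ℚ) := by
        push_cast [Nat.cast_sub hk'.le]; ring
      rw [this]
      exact ((ReducesTo.natCast _).div (ReducesTo.natCast _)
        (ZMod.natCast_ne_zero_of_pos_of_lt (by omega) (by omega))).mul (hc k hk' (by omega))
  choose! c hc using key
  refine ⟨fun i => (-1) ^ i * c i, fun i hi => ?_⟩
  rw [bernoulli]
  simpa using ((ReducesTo.intCast (-1)).pow i).mul (hc i hi)

/-- `(1 / p) ∑_{x < p} x ^ k ≡ B_k (mod p)`. -/
lemma sum_range_pow_div_reducesTo {p k : ℕ} [Fact p.Prime] (hk : k + 1 < p) {b : ZMod p}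
    (hb : ReducesTo p (bernoulli k) b) :
    ReducesTo p ((∑ x ∈ range p, (x : ℚ) ^ k) / p) b := by
  obtain ⟨c, hc⟩ := exists_bernoulli_reducesTo p
  have hp0 : (p : ℚ) ≠ 0 := by exact_mod_cast (Fact.out : p.Prime).ne_zero
  have hk1 : ((k + 1 : ℕ) : ZMod p) ≠ 0 :=
    ZMod.natCast_ne_zero_of_pos_of_lt (by omega) hk
  have h1 : (∑ x ∈ range p, (x : ℚ) ^ k) / p =
      ∑ i ∈ range (k + 1), bernoulli i * ((k + 1).choose i : ℕ) * ((p : ℕ) : ℚ) ^ (k - i)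
        / ((k + 1 : ℕ) : ℚ) := by
    rw [sum_range_pow, sum_div]
    refine sum_congr rfl fun i hi => ?_
    rw [show k + 1 - i = (k - i) + 1 by have := mem_range.1 hi; omega,
      pow_succ]
    push_cast
    field_simp
  have h2 : ReducesTo p ((∑ x ∈ range p, (x : ℚ) ^ k) / p)
      (∑ i ∈ range (k + 1), c i * ((k + 1).choose i : ℕ) * ((p : ℕ) : ZMod p) ^ (k - i)
        / ((k + 1 : ℕ) : ZMod p)) := by
    rw [h1]
    refine ReducesTo.sum fun i hi => ?_
    have := mem_range.1 hi
    exact (((hc i (by omega)).mul (ReducesTo.natCast _)).mul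
      ((ReducesTo.natCast _).pow _)).div (ReducesTo.natCast _) hk1
  convert h2 using 1
  rw [sum_range_succ, sum_eq_zero, hb.unique (hc k hk)]
  · simp only [Nat.sub_self, pow_zero, Nat.choose_succ_self_right]
    field_simp
    simp
  · intro i hi
    have := mem_range.1 hi
    simp [show k - i ≠ 0 by omega]

lemma sum_range_natCast_zmod {p : ℕ} [NeZero p] {M : Type*} [AddCommMonoid M] (F : ZMod p → M) :
    ∑ x ∈ range p, F (x : ZMod p) = ∑ z : ZMod p, F z := by
  refine sum_bij' (fun x _ => (x : ZMod p)) (fun z _ => z.val) (by simp)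
    (fun z _ => mem_range.2 (ZMod.val_lt z)) (fun x hx => ?_) (by simp) (by simp)
  exact ZMod.val_cast_of_lt (mem_range.1 hx)

lemma sum_zmod_mul_left {p : ℕ} [Fact p.Prime] {M : Type*} [AddCommMonoid M] (F : ZMod p → M)
    {c : ZMod p} (hc : c ≠ 0) : ∑ z : ZMod p, F (c * z) = ∑ z : ZMod p, F z :=
  Equiv.sum_comp (Equiv.mulLeft₀ c hc) F

lemma sum_range_mul_mod {p q : ℕ} [Fact p.Prime] (hq : (q : ZMod p) ≠ 0) {M : Type*}
    [AddCommMonoid M] (f : ℕ → M) :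
    ∑ x ∈ range p, f (q * x % p) = ∑ x ∈ range p, f x := by
  have h1 := sum_range_natCast_zmod (p := p) (fun z => f (q * z).val)
  have h2 := sum_range_natCast_zmod (p := p) (fun z => f z.val)
  rw [sum_zmod_mul_left (fun z => f z.val) hq, ← h2] at h1
  convert h1 using 1
  · refine sum_congr rfl fun x _ => ?_
    rw [← Nat.cast_mul, ZMod.val_natCast]
  · refine sum_congr rfl fun x hx => ?_
    rw [ZMod.val_cast_of_lt (mem_range.1 hx)]

/-- A congruence of Voronoi type modulo a prime. -/
lemma voronoi_congr {p q k : ℕ} [Fact p.Prime] (hq : (q : ZMod p) ≠ 0) (hk : k + 1 < p)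
    {b : ZMod p} (hb : ReducesTo p (bernoulli k) b) :
    ((q : ZMod p) ^ k - 1) * b =
      k * q ^ (k - 1) * ∑ x ∈ range p, ((q * x / p : ℕ) : ZMod p) * (x : ZMod p) ^ (k - 1) := by
  have hp0 : (p : ℚ) ≠ 0 := by exact_mod_cast (Fact.out : p.Prime).ne_zero
  have h1 : ∀ x : ℕ, ∃ z : ℤ, ((q : ℤ) * x) ^ k = ((q * x % p : ℕ) : ℤ) ^ k +
      p * (k * ((q * x % p : ℕ) : ℤ) ^ (k - 1) * (q * x / p : ℕ)) + p ^ 2 * z := by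
    intro x
    obtain ⟨z, hz⟩ := Polynomial.powAddExpansion ((q * x % p : ℕ) : ℤ) (p * (q * x / p : ℕ)) k
    refine ⟨z * ((q * x / p : ℕ) : ℤ) ^ 2, ?_⟩
    have : ((q : ℤ) * x) = ((q * x % p : ℕ) : ℤ) + p * (q * x / p : ℕ) := by
      exact_mod_cast (Nat.mod_add_div (q * x) p).symm
    rw [this, hz]
    ring
  choose z hz using h1
  have h2 : ((q : ℤ) ^ k - 1) * ∑ x ∈ range p, (x : ℤ) ^ k =
      p * (k * ∑ x ∈ range p, ((q * x % p : ℕ) : ℤ) ^ (k - 1) * (q * x / p : ℕ)) +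
      p ^ 2 * ∑ x ∈ range p, z x := by
    have h3 : ∑ x ∈ range p, ((q : ℤ) * x) ^ k = _ := sum_congr rfl fun x _ => hz x
    rw [sum_add_distrib, sum_add_distrib,
      sum_range_mul_mod hq (fun n : ℕ => (n : ℤ) ^ k), ← mul_sum, ← mul_sum] at h3
    simp only [mul_pow, mul_assoc] at h3
    rw [← mul_sum, ← mul_sum] at h3
    linear_combination h3
  have h3 : ((q : ℚ) ^ k - 1) * ((∑ x ∈ range p, (x : ℚ) ^ k) / p) =
      ((k * ∑ x ∈ range p, ((q * x % p : ℕ) : ℤ) ^ (k - 1) * (q * x / p : ℕ) +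
        p * ∑ x ∈ range p, z x : ℤ) : ℚ) := by
    have h2' := congrArg (Int.cast : ℤ → ℚ) h2
    push_cast at h2' ⊢
    rw [mul_div_assoc', h2']
    field_simp
  have h4 := (((ReducesTo.natCast q).pow k).sub ReducesTo.one).mul
    (sum_range_pow_div_reducesTo hk hb)
  rw [h3] at h4
  rw [h4.unique (ReducesTo.intCast _)]
  simp only [Int.cast_add, Int.cast_mul, Int.cast_sum, Int.cast_pow, Int.cast_natCast,
    ZMod.natCast_mod, ZMod.natCast_self, zero_mul, add_zero, mul_assoc]
  rw [mul_sum _ _ ((q : ZMod p) ^ (k - 1))]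
  congr 1
  refine sum_congr rfl fun x _ => ?_
  rw [Nat.cast_mul, mul_pow]
  ring

lemma sum_range_mul_eq_sum_sum {M : Type*} [AddCommMonoid M] (a b : ℕ) (f : ℕ → M) :
    ∑ i ∈ range (a * b), f i = ∑ s ∈ range b, ∑ x ∈ range a, f (a * s + x) := by
  induction b with
  | zero => simp
  | succ b ih => rw [mul_add_one, sum_range_add, ih, sum_range_succ]

lemma sum_range_mul_of_dvd {M : Type*} [AddCommMonoid M] {a : ℕ} (ha : 0 < a) (b : ℕ)
    {f : ℕ → M} (hf : ∀ i, ¬ a ∣ i → f i = 0) :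
    ∑ i ∈ range (a * b), f i = ∑ s ∈ range b, f (a * s) := by
  rw [sum_range_mul_eq_sum_sum]
  refine sum_congr rfl fun s _ => ?_
  rw [sum_eq_single_of_mem 0 (mem_range.2 ha), add_zero]
  intro x hx hx0
  refine hf _ fun h => hx0 (Nat.eq_zero_of_dvd_of_lt ?_ (mem_range.1 hx))
  exact (Nat.dvd_add_right (dvd_mul_right a s)).1 h

lemma sum_range_succ_ite_dvd {R : Type*} [Ring R] (p m : ℕ) (c : R) :
    ∑ i ∈ range (m + 1), (if p ∣ i then c else 0) = ((m / p : ℕ) + 1 : R) * c := by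
  induction m with
  | zero => simp
  | succ m ih =>
    rw [sum_range_succ, ih, Nat.succ_div]
    split_ifs
    · push_cast; noncomm_ring
    · simp

section HarmonicSums

open PowerSeries

variable (p : ℕ)

/-- The sum of the inverses of `0, …, m` in `ZMod p`, where `0⁻¹ = 0`. -/
def harmonicMod (m : ℕ) : ZMod p := ∑ j ∈ range (m + 1), (j : ZMod p)⁻¹

/-- The residue modulo `p` of the double harmonic sum `∑ 1 / (j x²)` over `j ≤ x < p`. -/
def doubleHarmonicMod : ZMod p := ∑ x ∈ range p, (x : ZMod p)⁻¹ ^ 2 * harmonicMod p x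

/-- The power series `∑ X ^ i / i` over the `i` prime to `p`, with coefficients in `ZMod p`. -/
noncomputable def invSeries : PowerSeries (ZMod p) := PowerSeries.mk fun i => (i : ZMod p)⁻¹

/-- The part of `invSeries p` supported on the multiples of `q`. -/
noncomputable def invSeriesMul (q : ℕ) : PowerSeries (ZMod p) :=
  PowerSeries.mk fun i => if q ∣ i then (i : ZMod p)⁻¹ else 0

variable {p} [Fact p.Prime]

lemma sum_zmod_eq_zero_of_odd (hp2 : p ≠ 2) {F : ZMod p → ZMod p} (hF : ∀ z, F (-z) = -F z) :
    ∑ z, F z = 0 := by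
  have h : ∑ z, F z = -∑ z, F z := by
    rw [← sum_neg_distrib, ← Equiv.sum_comp (Equiv.neg _) F]
    exact sum_congr rfl fun z _ => hF z
  have h2 : (2 : ZMod p) ≠ 0 := by
    have hp : p.Prime := Fact.out
    have := hp.two_le
    exact_mod_cast ZMod.natCast_ne_zero_of_pos_of_lt (p := p) two_pos (by omega)
  have h3 : 2 * ∑ z, F z = 0 := by linear_combination h
  exact (mul_eq_zero.1 h3).resolve_left h2

lemma sum_range_inv (hp2 : p ≠ 2) : ∑ x ∈ range p, (x : ZMod p)⁻¹ = 0 := by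
  rw [sum_range_natCast_zmod (fun z => z⁻¹)]
  exact sum_zmod_eq_zero_of_odd hp2 fun z => inv_neg

lemma sum_range_inv_pow_three (hp2 : p ≠ 2) : ∑ x ∈ range p, (x : ZMod p)⁻¹ ^ 3 = 0 := by
  rw [sum_range_natCast_zmod (fun z => z⁻¹ ^ 3)]
  exact sum_zmod_eq_zero_of_odd hp2 fun z => by rw [inv_neg]; ring

lemma harmonicMod_mul_add (hp2 : p ≠ 2) (s x : ℕ) :
    harmonicMod p (p * s + x) = harmonicMod p x := by
  unfold harmonicMod
  rw [add_assoc, sum_range_add, sum_range_mul_eq_sum_sum]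
  simp [sum_range_inv hp2]

lemma harmonicMod_mod (hp2 : p ≠ 2) (m : ℕ) : harmonicMod p (m % p) = harmonicMod p m := by
  conv_rhs => rw [← Nat.div_add_mod m p, harmonicMod_mul_add hp2]

lemma coeff_invSeries_sq {m : ℕ} (hm : (m : ZMod p) ≠ 0) :
    coeff m (invSeries p * invSeries p) =
      2 * (m : ZMod p)⁻¹ * harmonicMod p m - 2 * ((m / p : ℕ) + 1) * (m : ZMod p)⁻¹ ^ 2 := by
  rw [coeff_mul, Nat.sum_antidiagonal_eq_sum_range_succ
    (fun i j => coeff i (invSeries p) * coeff j (invSeries p))]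
  simp only [invSeries, coeff_mk]
  have h1 : ∀ i ∈ range (m + 1), (i : ZMod p)⁻¹ * ((m - i : ℕ) : ZMod p)⁻¹ =
      (m : ZMod p)⁻¹ * ((i : ZMod p)⁻¹ - if p ∣ i then (m : ZMod p)⁻¹ else 0) +
      (m : ZMod p)⁻¹ * (((m - i : ℕ) : ZMod p)⁻¹ -
        if p ∣ m - i then (m : ZMod p)⁻¹ else 0) := by
    intro i hi
    have him : i ≤ m := Nat.lt_succ_iff.1 (mem_range.1 hi)
    have hadd : (m : ZMod p) = i + ((m - i : ℕ) : ZMod p) := by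
      rw [← Nat.cast_add, Nat.add_sub_cancel' him]
    simp only [← ZMod.natCast_eq_zero_iff]
    generalize ((m - i : ℕ) : ZMod p) = y at *
    generalize (i : ZMod p) = x at *
    by_cases hx : x = 0
    · subst hx
      have hy : y ≠ 0 := by rintro rfl; simp_all
      simp_all
    · by_cases hy : y = 0
      · subst hy; simp_all
      · rw [if_neg hx, if_neg hy, hadd]
        rw [hadd] at hm
        field_simp
        ring
  have h2 := sum_range_reflect (fun j : ℕ => (m : ZMod p)⁻¹ * ((j : ZMod p)⁻¹ -
    if p ∣ j then (m : ZMod p)⁻¹ else 0)) (m + 1)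
  simp only [Nat.add_sub_cancel] at h2
  rw [sum_congr rfl h1, sum_add_distrib, h2, ← mul_sum, sum_sub_distrib,
    sum_range_succ_ite_dvd, ← harmonicMod]
  ring

lemma inv_mul_coeff_invSeries_sq (m : ℕ) :
    (m : ZMod p)⁻¹ * coeff m (invSeries p * invSeries p) =
      2 * ((m : ZMod p)⁻¹ ^ 2 * harmonicMod p m) -
        2 * (((m / p : ℕ) + 1) * (m : ZMod p)⁻¹ ^ 3) := by
  by_cases hm : (m : ZMod p) = 0
  · simp [hm]
  · rw [coeff_invSeries_sq hm]; ring

lemma natCast_sub_inv_of_dvd {n m : ℕ} (hn : (n : ZMod p) = 0) (hm : m ≤ n) :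
    ((n - m : ℕ) : ZMod p)⁻¹ = -(m : ZMod p)⁻¹ := by
  rw [Nat.cast_sub hm, hn, zero_sub, inv_neg]

lemma coeff_invSeries_cube (hp2 : p ≠ 2) (r : ℕ) :
    coeff (p * r) (invSeries p * (invSeries p * invSeries p)) =
      -2 * r * doubleHarmonicMod p := by
  have hn : ((p * r : ℕ) : ZMod p) = 0 := by simp
  rw [mul_comm (invSeries p), coeff_mul, Nat.sum_antidiagonal_eq_sum_range_succ
    (fun i j => coeff i (invSeries p * invSeries p) * coeff j (invSeries p))]
  have h1 : ∀ m ∈ range (p * r + 1), coeff m (invSeries p * invSeries p) *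
      coeff (p * r - m) (invSeries p) =
      2 * (((m / p : ℕ) + 1) * (m : ZMod p)⁻¹ ^ 3) -
        2 * ((m : ZMod p)⁻¹ ^ 2 * harmonicMod p m) := by
    intro m hm
    have := inv_mul_coeff_invSeries_sq (p := p) m
    rw [invSeries, coeff_mk, ← invSeries,
      natCast_sub_inv_of_dvd hn (Nat.lt_succ_iff.1 (mem_range.1 hm))]
    linear_combination -this
  have hp : 0 < p := (Fact.out : p.Prime).pos
  rw [sum_congr rfl h1, sum_range_succ, hn, sum_range_mul_eq_sum_sum]
  have h2 : ∀ s ∈ range r, ∑ x ∈ range p, (2 * ((((p * s + x) / p : ℕ) + 1) *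
      ((p * s + x : ℕ) : ZMod p)⁻¹ ^ 3) -
        2 * (((p * s + x : ℕ) : ZMod p)⁻¹ ^ 2 * harmonicMod p (p * s + x))) =
      -2 * doubleHarmonicMod p := by
    intro s _
    have h3 : ∀ x ∈ range p, (2 * ((((p * s + x) / p : ℕ) + 1) *
      ((p * s + x : ℕ) : ZMod p)⁻¹ ^ 3) -
        2 * (((p * s + x : ℕ) : ZMod p)⁻¹ ^ 2 * harmonicMod p (p * s + x))) =
        2 * (s + 1) * (x : ZMod p)⁻¹ ^ 3 - 2 * ((x : ZMod p)⁻¹ ^ 2 * harmonicMod p x) := by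
      intro x hx
      rw [harmonicMod_mul_add hp2, Nat.mul_add_div hp, Nat.div_eq_of_lt (mem_range.1 hx)]
      push_cast
      simp only [CharP.cast_eq_zero, zero_mul, zero_add, add_zero]
      ring
    rw [sum_congr rfl h3, sum_sub_distrib, ← mul_sum, ← mul_sum, sum_range_inv_pow_three hp2,
      ← doubleHarmonicMod]
    ring
  rw [sum_congr rfl h2]
  simp
  ring

lemma sum_inv_sq_mul_harmonicMod_mul (hp2 : p ≠ 2) {q : ℕ} (hq : (q : ZMod p) ≠ 0) :
    ∑ x ∈ range p, ((q * x : ℕ) : ZMod p)⁻¹ ^ 2 * harmonicMod p (q * x) =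
      doubleHarmonicMod p := by
  rw [doubleHarmonicMod,
    ← sum_range_mul_mod hq (fun x : ℕ => (x : ZMod p)⁻¹ ^ 2 * harmonicMod p x)]
  refine sum_congr rfl fun x _ => ?_
  rw [harmonicMod_mod hp2, ZMod.natCast_mod]

lemma coeff_invSeriesMul_mul_sq (hp2 : p ≠ 2) {q : ℕ} (hq : (q : ZMod p) ≠ 0) :
    coeff (p * q) (invSeriesMul p q * (invSeries p * invSeries p)) =
      -2 * doubleHarmonicMod p + 2 * (q : ZMod p)⁻¹ ^ 3 *
        ∑ x ∈ range p, ((q * x / p : ℕ) : ZMod p) * (x : ZMod p)⁻¹ ^ 3 := by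
  have hn : ((p * q : ℕ) : ZMod p) = 0 := by simp
  have hq0 : 0 < q := Nat.pos_of_ne_zero (by rintro rfl; simp at hq)
  rw [mul_comm (invSeriesMul p q), coeff_mul, Nat.sum_antidiagonal_eq_sum_range_succ
    (fun i j => coeff i (invSeries p * invSeries p) * coeff j (invSeriesMul p q))]
  have h1 : ∀ m ∈ range (p * q + 1), coeff m (invSeries p * invSeries p) *
      coeff (p * q - m) (invSeriesMul p q) = if q ∣ m then
      2 * (((m / p : ℕ) + 1) * (m : ZMod p)⁻¹ ^ 3) -
        2 * ((m : ZMod p)⁻¹ ^ 2 * harmonicMod p m) else 0 := by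
    intro m hm
    have := inv_mul_coeff_invSeries_sq (p := p) m
    have hm := Nat.lt_succ_iff.1 (mem_range.1 hm)
    rw [invSeriesMul, coeff_mk, natCast_sub_inv_of_dvd hn hm]
    simp only [Nat.dvd_sub_iff_right hm (dvd_mul_left q p)]
    split_ifs
    · linear_combination -this
    · simp
  rw [sum_congr rfl h1, sum_range_succ, hn, mul_comm p q,
    sum_range_mul_of_dvd hq0 p (fun i hi => if_neg hi)]
  simp only [dvd_mul_right, if_true]
  have h2 : ∀ x ∈ range p, (2 * ((((q * x) / p : ℕ) + 1) * ((q * x : ℕ) : ZMod p)⁻¹ ^ 3) -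
      2 * (((q * x : ℕ) : ZMod p)⁻¹ ^ 2 * harmonicMod p (q * x))) =
      2 * (q : ZMod p)⁻¹ ^ 3 * (((q * x / p : ℕ) : ZMod p) * (x : ZMod p)⁻¹ ^ 3) +
      2 * (q : ZMod p)⁻¹ ^ 3 * (x : ZMod p)⁻¹ ^ 3 -
      2 * (((q * x : ℕ) : ZMod p)⁻¹ ^ 2 * harmonicMod p (q * x)) := by
    intro x _
    rw [Nat.cast_mul, mul_inv]
    ring
  rw [sum_congr rfl h2, sum_sub_distrib, sum_add_distrib, ← mul_sum, ← mul_sum, ← mul_sum,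
    sum_inv_sq_mul_harmonicMod_mul hp2 hq, sum_range_inv_pow_three hp2]
  simp
  ring

lemma invSeriesMul_eq_expand {q : ℕ} (hq : q ≠ 0) :
    invSeriesMul p q = C (q : ZMod p)⁻¹ * PowerSeries.expand q hq (invSeries p) := by
  ext i
  rw [coeff_C_mul, invSeriesMul, coeff_mk]
  split_ifs with h
  · obtain ⟨j, rfl⟩ := h
    rw [PowerSeries.coeff_expand_mul, invSeries, coeff_mk, Nat.cast_mul, mul_inv]
  · rw [PowerSeries.coeff_expand_of_not_dvd q hq _ h, mul_zero]

lemma coeff_invSeriesMul_cube (hp2 : p ≠ 2) {q : ℕ} (hq : q ≠ 0) :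
    coeff (p * q) (invSeriesMul p q * (invSeriesMul p q * invSeriesMul p q)) =
      -2 * (q : ZMod p)⁻¹ ^ 3 * doubleHarmonicMod p := by
  have h : invSeriesMul p q * (invSeriesMul p q * invSeriesMul p q) =
      C ((q : ZMod p)⁻¹ ^ 3) *
        PowerSeries.expand q hq (invSeries p * (invSeries p * invSeries p)) := by
    rw [invSeriesMul_eq_expand hq, map_mul, map_mul, map_pow]
    ring
  have h1 := coeff_invSeries_cube hp2 1
  rw [mul_one] at h1
  rw [h, coeff_C_mul, mul_comm p q, PowerSeries.coeff_expand_mul, h1]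
  push_cast
  ring

lemma coeff_sub_mul_invSeriesMul_sq (q : ℕ) :
    coeff (p * q) ((invSeries p - invSeriesMul p q) * (invSeriesMul p q * invSeriesMul p q)) =
      0 := by
  rw [coeff_mul]
  refine sum_eq_zero fun x hx => ?_
  have hx := mem_antidiagonal.1 hx
  by_cases h : q ∣ x.1
  · simp [invSeries, invSeriesMul, h]
  · rw [coeff_mul, sum_eq_zero, mul_zero]
    intro y hy
    have hy := mem_antidiagonal.1 hy
    by_cases h1 : q ∣ y.1
    · have h2 : ¬ q ∣ y.2 := fun h2 => h <|
        (Nat.dvd_add_left (hy ▸ dvd_add h1 h2)).1 (hx ▸ dvd_mul_left q p)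
      simp [invSeriesMul, h2]
    · simp [invSeriesMul, h1]

lemma coeff_sub_cube (hp2 : p ≠ 2) {q : ℕ} (hq : (q : ZMod p) ≠ 0) :
    coeff (p * q) ((invSeries p - invSeriesMul p q) *
        ((invSeries p - invSeriesMul p q) * (invSeries p - invSeriesMul p q))) =
      (6 - 2 * q - 4 * (q : ZMod p)⁻¹ ^ 3) * doubleHarmonicMod p - 6 * (q : ZMod p)⁻¹ ^ 3 *
        ∑ x ∈ range p, ((q * x / p : ℕ) : ZMod p) * (x : ZMod p)⁻¹ ^ 3 := by
  have hq0 : q ≠ 0 := by rintro rfl; simp at hq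
  have h : (invSeries p - invSeriesMul p q) *
        ((invSeries p - invSeriesMul p q) * (invSeries p - invSeriesMul p q)) =
      invSeries p * (invSeries p * invSeries p) -
      C 3 * (invSeriesMul p q * (invSeries p * invSeries p)) +
      C 3 * ((invSeries p - invSeriesMul p q) * (invSeriesMul p q * invSeriesMul p q)) +
      C 2 * (invSeriesMul p q * (invSeriesMul p q * invSeriesMul p q)) := by
    rw [map_ofNat, map_ofNat]
    ring
  rw [h, map_add, map_add, map_sub, coeff_C_mul, coeff_C_mul, coeff_C_mul,
    coeff_invSeries_cube hp2, coeff_invSeriesMul_mul_sq hp2 hq, coeff_invSeriesMul_cube hp2 hq0,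
    coeff_sub_mul_invSeriesMul_sq]
  ring

end HarmonicSums

/-- `∑ x ^ (e - 2)` over the nonzero `x` in `ZMod p`. -/
lemma sum_range_inv_sq_mul_pow {p e : ℕ} [Fact p.Prime] (hp2 : p ≠ 2) (he0 : 0 < e)
    (he : e < p) :
    ∑ x ∈ range p, (x : ZMod p)⁻¹ ^ 2 * (x : ZMod p) ^ e = if e = 2 then -1 else 0 := by
  rw [sum_range_natCast_zmod (fun z => z⁻¹ ^ 2 * z ^ e)]
  obtain rfl | rfl | ⟨d, rfl⟩ : e = 1 ∨ e = 2 ∨ ∃ d, e = d + 3 := by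
    rcases e with _ | _ | _ | d <;> simp_all
  · rw [if_neg (by norm_num)]
    refine sum_zmod_eq_zero_of_odd hp2 fun z => ?_
    rw [inv_neg]; ring
  · rw [if_pos rfl]
    have h : ∀ z : ZMod p, z⁻¹ ^ 2 * z ^ 2 = 1 - if z = 0 then 1 else 0 := by
      intro z
      split_ifs with hz
      · simp [hz]
      · field_simp; simp
    rw [sum_congr rfl fun z _ => h z]
    simp
  · rw [if_neg (by omega), ← FiniteField.sum_pow_lt_card_sub_one (ZMod p) (d + 1)
      (by rw [ZMod.card]; omega)]
    refine sum_congr rfl fun z _ => ?_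
    by_cases hz : z = 0
    · simp [hz]
    · field_simp
      ring

lemma sum_range_pow_zmod {p : ℕ} [Fact p.Prime] {c : ℕ → ZMod p}
    (hc : ∀ i, i + 1 < p → ReducesTo p (bernoulli i) (c i)) {k : ℕ} (hk : k + 1 < p) (m : ℕ) :
    ∑ x ∈ range m, (x : ZMod p) ^ k =
      ∑ i ∈ range (k + 1), c i * ((k + 1).choose i : ℕ) * (m : ZMod p) ^ (k + 1 - i)
        / ((k + 1 : ℕ) : ZMod p) := by
  have h1 : ReducesTo p (∑ x ∈ range m, (x : ℚ) ^ k) (∑ x ∈ range m, (x : ZMod p) ^ k) :=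
    ReducesTo.sum fun x _ => (ReducesTo.natCast x).pow k
  refine h1.unique ?_
  rw [sum_range_pow]
  refine ReducesTo.sum fun i hi => ?_
  have := mem_range.1 hi
  have h2 := ReducesTo.natCast (p := p) (k + 1)
  push_cast at h2
  have h3 := ZMod.natCast_ne_zero_of_pos_of_lt (p := p) k.succ_pos hk
  push_cast at h3 ⊢
  exact (((hc i (by omega)).mul (ReducesTo.natCast _)).mul
    ((ReducesTo.natCast _).pow _)).div h2 h3

/-- The double harmonic sum `∑ 1 / (j x²)` over `j ≤ x < p` is congruent to `B_{p-3}`. -/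
lemma doubleHarmonicMod_eq {p : ℕ} [Fact p.Prime] (hp2 : p ≠ 2) {b : ZMod p}
    (hb : ReducesTo p (bernoulli (p - 3)) b) : doubleHarmonicMod p = b := by
  obtain ⟨c, hc⟩ := exists_bernoulli_reducesTo p
  have hp : p.Prime := Fact.out
  obtain ⟨m, rfl⟩ : ∃ m, p = m + 3 := ⟨p - 3, by have := hp.two_le; omega⟩
  have hinv : ∀ z : ZMod (m + 3), z⁻¹ = z ^ (m + 1) := by
    intro z
    by_cases hz : z = 0
    · simp [hz]
    · have := ZMod.pow_card_sub_one_eq_one hz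
      rw [show m + 3 - 1 = (m + 1) + 1 from rfl, pow_succ] at this
      exact (eq_inv_of_mul_eq_one_left this).symm
  have h1 : ∀ x : ℕ, harmonicMod (m + 3) x = (∑ i ∈ range (m + 2),
      c i * ((m + 2).choose i : ℕ) * (x : ZMod (m + 3)) ^ (m + 2 - i)
        / ((m + 2 : ℕ) : ZMod (m + 3))) + (x : ZMod (m + 3))⁻¹ := by
    intro x
    rw [harmonicMod, sum_range_succ, ← sum_range_pow_zmod hc (by omega) x]
    simp only [hinv]
  have h2 : doubleHarmonicMod (m + 3) = ∑ i ∈ range (m + 2), c i * ((m + 2).choose i : ℕ) /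
      ((m + 2 : ℕ) : ZMod (m + 3)) * if m + 2 - i = 2 then -1 else 0 := by
    rw [doubleHarmonicMod]
    simp only [h1, mul_add, sum_add_distrib, ← pow_succ, sum_range_inv_pow_three hp2, add_zero]
    simp only [mul_sum]
    rw [sum_comm]
    refine sum_congr rfl fun i hi => ?_
    have := mem_range.1 hi
    rw [← sum_range_inv_sq_mul_pow (p := m + 3) hp2 (by omega) (by omega), mul_sum]
    refine sum_congr rfl fun x _ => ?_
    ring
  rw [h2, sum_eq_single_of_mem m (by simp)
    (fun i hi him => by rw [if_neg (by have := mem_range.1 hi; omega), mul_zero])]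
  rw [if_pos (by omega), hb.unique (hc m (by omega))]
  have h0 : ((m : ZMod (m + 3)) + 3) = 0 := by
    have := ZMod.natCast_self (m + 3)
    push_cast at this
    exact this
  have h3 : (2 : ZMod (m + 3)) ≠ 0 := by
    exact_mod_cast ZMod.natCast_ne_zero_of_pos_of_lt (p := m + 3) two_pos (by omega)
  have h4 : ((m + 2 : ℕ) : ZMod (m + 3)) = -1 := by
    push_cast; linear_combination h0
  have h5 : (((m + 2).choose m : ℕ) : ZMod (m + 3)) = 1 := by
    have h6 := congrArg (Nat.cast : ℕ → ZMod (m + 3)) (Nat.add_one_mul_choose_eq (m + 1) 1)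
    rw [← Nat.choose_symm_of_eq_add (show m + 2 = m + 2 from rfl), Nat.choose_one_right] at h6
    push_cast at h6
    refine mul_right_cancel₀ h3 ?_
    linear_combination -h6 + m * h0
  rw [h4, h5]
  simp [div_neg]

lemma three_mul_sum_div_mul_inv_cube {p q : ℕ} [Fact p.Prime] (hp2 : p ≠ 2)
    (hq : (q : ZMod p) ≠ 0) {b : ZMod p} (hb : ReducesTo p (bernoulli (p - 3)) b) :
    3 * ∑ x ∈ range p, ((q * x / p : ℕ) : ZMod p) * (x : ZMod p)⁻¹ ^ 3 =
      ((q : ZMod p) ^ 3 - q) * b := by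
  have hp : p.Prime := Fact.out
  by_cases hp3 : p = 3
  · subst hp3
    have h3 : (3 : ZMod 3) = 0 := rfl
    rw [h3, ZMod.pow_card]
    ring
  obtain ⟨k, rfl⟩ : ∃ k, p = k + 4 := ⟨p - 4, by have := hp.two_le; omega⟩
  have hinv : ∀ z : ZMod (k + 4), z⁻¹ ^ 3 = z ^ k := by
    intro z
    by_cases hz : z = 0
    · have hk : k ≠ 0 := by rintro rfl; revert hp; norm_num
      simp [hz, hk]
    · have := ZMod.pow_card_sub_one_eq_one hz
      rw [show k + 4 - 1 = k + 3 from rfl, pow_add] at this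
      field_simp
      rw [mul_comm, this]
  have h := voronoi_congr hq (by omega) hb
  rw [show k + 4 - 3 = k + 1 from rfl, Nat.add_sub_cancel] at h
  simp only [← hinv] at h
  rw [pow_succ, ← hinv] at h
  have h0 : ((k : ZMod (k + 4)) + 4) = 0 := by
    have := ZMod.natCast_self (k + 4)
    push_cast at this
    exact this
  generalize ∑ x ∈ range (k + 4), ((q * x / (k + 4) : ℕ) : ZMod (k + 4)) *
    (x : ZMod (k + 4))⁻¹ ^ 3 = V at *
  rw [show ((k + 1 : ℕ) : ZMod (k + 4)) = -3 by push_cast; linear_combination h0] at h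
  field_simp at h
  linear_combination h

lemma sum_Icc_one_eq_sum_range {M : Type*} [AddCommMonoid M] {f : ℕ → M} (hf : f 0 = 0)
    (n : ℕ) : ∑ i ∈ Icc 1 n, f i = ∑ i ∈ range (n + 1), f i := by
  refine sum_subset (fun i hi => ?_) (fun i _ hi' => ?_)
  · have := mem_Icc.1 hi
    exact mem_range.2 (by omega)
  · have h1 := mem_range.1 ‹_›
    rw [mem_Icc] at hi'
    rw [show i = 0 by omega, hf]

open PowerSeries in
lemma coeff_cube_eq_sum_Icc {R : Type*} [CommRing R] {W : PowerSeries R}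
    (hW : coeff 0 W = 0) (n : ℕ) :
    coeff n (W * (W * W)) = ∑ i ∈ Icc 1 n, ∑ j ∈ Icc 1 n, ∑ k ∈ Icc 1 n,
      if i + j + k = n then coeff i W * coeff j W * coeff k W else 0 := by
  rw [coeff_mul, Nat.sum_antidiagonal_eq_sum_range_succ
    (fun i j => coeff i W * coeff j (W * W)), sum_Icc_one_eq_sum_range (by simp [hW])]
  refine sum_congr rfl fun i hi => ?_
  have hin := Nat.lt_succ_iff.1 (mem_range.1 hi)
  rw [coeff_mul, Nat.sum_antidiagonal_eq_sum_range_succ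
    (fun i j => coeff i W * coeff j W), sum_Icc_one_eq_sum_range (by simp [hW]), mul_sum]
  have h1 : ∀ j ∈ range (n + 1), (∑ k ∈ Icc 1 n,
      if i + j + k = n then coeff i W * coeff j W * coeff k W else 0) =
      if i + j ≤ n then coeff i W * coeff j W * coeff (n - i - j) W else 0 := by
    intro j _
    rw [sum_Icc_one_eq_sum_range (by simp [hW])]
    split_ifs with h
    · rw [sum_eq_single_of_mem (n - i - j) (mem_range.2 (by omega)), if_pos (by omega)]
      intro k _ hk
      exact if_neg (by omega)
    · exact sum_eq_zero fun k _ => if_neg (by omega)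
  rw [sum_congr rfl h1]
  symm
  rw [← sum_subset (range_subset_range.2 (show n - i + 1 ≤ n + 1 by omega))]
  · refine sum_congr rfl fun j hj => ?_
    have := mem_range.1 hj
    rw [if_pos (by omega), mul_assoc]
  · intro j _ hj
    rw [mem_range] at hj
    exact if_neg (by omega)

open PowerSeries in
lemma Z_reducesTo {p q : ℕ} [Fact p.Prime] (hq : q.Prime) :
    ReducesTo p (Z (p * q)) (coeff (p * q) ((invSeries p - invSeriesMul p q) *
        ((invSeries p - invSeriesMul p q) * (invSeries p - invSeriesMul p q)))) := by
  have hp : p.Prime := Fact.out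
  have hcop : ∀ i, Nat.Coprime i (p * q) ↔ (i : ZMod p) ≠ 0 ∧ ¬ q ∣ i := by
    intro i
    rw [Nat.coprime_mul_iff_right, i.coprime_comm, hp.coprime_iff_not_dvd,
      i.coprime_comm, hq.coprime_iff_not_dvd, Ne, ZMod.natCast_eq_zero_iff]
  have hW : ∀ i, coeff i (invSeries p - invSeriesMul p q) =
      if Nat.Coprime i (p * q) then (i : ZMod p)⁻¹ else 0 := by
    intro i
    rw [map_sub, invSeries, invSeriesMul, coeff_mk, coeff_mk]
    simp only [hcop]
    by_cases h1 : (i : ZMod p) = 0 <;> by_cases h2 : q ∣ i <;> simp [h1, h2]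
  rw [coeff_cube_eq_sum_Icc (by rw [hW]; simp), Z]
  refine ReducesTo.sum fun i _ => ReducesTo.sum fun j _ => ReducesTo.sum fun k _ => ?_
  rw [hW, hW, hW]
  by_cases h : i + j + k = p * q ∧ Nat.Coprime i (p * q) ∧ Nat.Coprime j (p * q) ∧
      Nat.Coprime k (p * q)
  · rw [if_pos h, if_pos h.1, if_pos h.2.1, if_pos h.2.2.1, if_pos h.2.2.2, one_div, mul_inv,
      mul_inv]
    exact (((ReducesTo.natCast i).inv ((hcop i).1 h.2.1).1).mul
      ((ReducesTo.natCast j).inv ((hcop j).1 h.2.2.1).1)).mul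
      ((ReducesTo.natCast k).inv ((hcop k).1 h.2.2.2).1)
  · rw [if_neg h]
    convert ReducesTo.natCast (p := p) 0 using 1
    · simp
    · split_ifs <;> simp_all

theorem Z_pq_congr (p q : ℕ) (hp : p.Prime) (hq : q.Prime) (hp2 : p ≠ 2) (hq2 : q ≠ 2)
    (hpq : p ≠ q) :
    ratCong p (Z (p * q)) (2 * (2 - (q : ℚ)) * (1 - 1 / (q : ℚ) ^ 3) * bernoulli (p - 3)) := by
  have : Fact p.Prime := ⟨hp⟩
  have hq0 : (q : ZMod p) ≠ 0 := fun h =>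
    hpq ((Nat.prime_dvd_prime_iff_eq hp hq).1 ((ZMod.natCast_eq_zero_iff q p).1 h))
  obtain ⟨c, hc⟩ := exists_bernoulli_reducesTo p
  have hb := hc (p - 3) (by have := hp.two_le; omega)
  have hZ := Z_reducesTo (p := p) hq
  have hrhs : ReducesTo p
      (2 * (2 - (q : ℚ)) * (1 - 1 / (q : ℚ) ^ 3) * bernoulli (p - 3))
      (2 * (2 - (q : ZMod p)) * (1 - 1 / (q : ZMod p) ^ 3) * c (p - 3)) := by
    have h2 : ReducesTo p 2 2 := by simpa using ReducesTo.natCast (p := p) 2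
    have hq' := ReducesTo.natCast (p := p) q
    exact ((h2.mul (h2.sub hq')).mul (ReducesTo.one.sub
      (ReducesTo.one.div (hq'.pow 3) (pow_ne_zero 3 hq0)))).mul hb
  refine hZ.ratCong ?_
  convert hrhs using 1
  rw [coeff_sub_cube hp2 hq0, doubleHarmonicMod_eq hp2 hb]
  have hV := three_mul_sum_div_mul_inv_cube hp2 hq0 hb
  generalize ∑ x ∈ range p, ((q * x / p : ℕ) : ZMod p) * (x : ZMod p)⁻¹ ^ 3 = V at *
  field_simp
  linear_combination -2 * hV
end

section
/- Let p and q be distinct odd primes and let α, β be positive integers. Then Z(p^α q^β) ≡ 2(2-q)(1 - 1/q³)·p^{α-1} q^{β-1}·B_{p-3} (mod p^α), as a congruence of rational numbers whose denominators are coprime to p. -/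
open Finset

/-- `p ^ k` divides `x` in the ring of `p`-integral rationals. -/
def PDvd (p k : ℕ) (x : ℚ) : Prop :=
  ∃ a b : ℤ, ¬ (p : ℤ) ∣ b ∧ x * b = p ^ k * a

namespace PDvd

variable {p : ℕ}

theorem cast_ne_zero {b : ℤ} (h : ¬ (p : ℤ) ∣ b) : (b : ℚ) ≠ 0 := by
  rintro h0
  exact h (by simp [Int.cast_eq_zero.1 h0])

theorem natCast_ne_zero {b : ℕ} (h : ¬ p ∣ b) : (b : ℚ) ≠ 0 := by
  rintro h0
  exact h (by simp [Nat.cast_eq_zero.1 h0])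

theorem of_eq {k : ℕ} {x : ℚ} (a b : ℤ) (hb : ¬ (p : ℤ) ∣ b) (h : x = p ^ k * a / b) :
    PDvd p k x :=
  ⟨a, b, hb, by rw [h, div_mul_cancel₀ _ (cast_ne_zero hb)]⟩

theorem neg {k : ℕ} {x : ℚ} (hx : PDvd p k x) : PDvd p k (-x) := by
  obtain ⟨a, b, hb, h⟩ := hx
  exact ⟨-a, b, hb, by push_cast; linear_combination -h⟩

theorem mono {j k : ℕ} {x : ℚ} (hx : PDvd p k x) (h : j ≤ k) : PDvd p j x := by
  obtain ⟨a, b, hb, e⟩ := hx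
  obtain ⟨d, rfl⟩ := Nat.exists_eq_add_of_le h
  exact ⟨p ^ d * a, b, hb, by push_cast; rw [e, pow_add]; ring⟩

theorem inv {n : ℕ} (h : ¬ p ∣ n) : PDvd p 0 (1 / (n : ℚ)) :=
  of_eq 1 n (by exact_mod_cast h) (by simp)

variable [hp : Fact p.Prime]

theorem not_dvd_mul {a b : ℤ} (ha : ¬ (p : ℤ) ∣ a) (hb : ¬ (p : ℤ) ∣ b) : ¬ (p : ℤ) ∣ a * b :=
  fun h => ((Nat.prime_iff_prime_int.1 hp.out).dvd_or_dvd h).elim ha hb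

theorem intCast (n : ℤ) : PDvd p 0 n :=
  ⟨n, 1, by simpa [Int.natCast_dvd] using hp.out.one_lt.ne', by simp⟩

theorem natCast (n : ℕ) : PDvd p 0 n := by
  simpa using intCast (p := p) n

theorem zero (k : ℕ) : PDvd p k 0 :=
  ⟨0, 1, by simpa [Int.natCast_dvd] using hp.out.one_lt.ne', by simp⟩

theorem add {k : ℕ} {x y : ℚ} (hx : PDvd p k x) (hy : PDvd p k y) : PDvd p k (x + y) := by
  obtain ⟨a, b, hb, h⟩ := hx
  obtain ⟨c, d, hd, h'⟩ := hy
  refine ⟨a * d + c * b, b * d, not_dvd_mul hb hd, ?_⟩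
  push_cast
  linear_combination (d : ℚ) * h + b * h'

theorem mul {j k : ℕ} {x y : ℚ} (hx : PDvd p j x) (hy : PDvd p k y) :
    PDvd p (j + k) (x * y) := by
  obtain ⟨a, b, hb, h⟩ := hx
  obtain ⟨c, d, hd, h'⟩ := hy
  refine ⟨a * c, b * d, not_dvd_mul hb hd, ?_⟩
  push_cast
  rw [pow_add]
  linear_combination (y * d : ℚ) * h + p ^ j * a * h'

theorem mul_left {k : ℕ} {x y : ℚ} (hx : PDvd p 0 x) (hy : PDvd p k y) : PDvd p k (x * y) := by
  simpa using hx.mul hy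

theorem mul_right {k : ℕ} {x y : ℚ} (hx : PDvd p k x) (hy : PDvd p 0 y) : PDvd p k (x * y) := by
  simpa using hx.mul hy

theorem sub {k : ℕ} {x y : ℚ} (hx : PDvd p k x) (hy : PDvd p k y) : PDvd p k (x - y) := by
  simpa [sub_eq_add_neg] using hx.add hy.neg

theorem sum {ι : Type*} {k : ℕ} (s : Finset ι) {f : ι → ℚ} (h : ∀ i ∈ s, PDvd p k (f i)) :
    PDvd p k (∑ i ∈ s, f i) := by
  classical
  induction s using Finset.induction_on with
  | empty => simpa using zero k
  | insert a s ha ih =>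
    rw [sum_insert ha]
    exact (h a (mem_insert_self _ _)).add (ih fun i hi => h i (mem_insert_of_mem hi))

theorem pow {x : ℚ} (hx : PDvd p 0 x) (n : ℕ) : PDvd p 0 (x ^ n) := by
  induction n with
  | zero => simpa using natCast (p := p) 1
  | succ n ih => rw [pow_succ]; exact ih.mul_left hx

theorem of_dvd {k n : ℕ} (h : p ^ k ∣ n) : PDvd p k n := by
  obtain ⟨m, rfl⟩ := h
  exact of_eq m 1 (by simpa [Int.natCast_dvd] using hp.out.one_lt.ne') (by simp)

theorem self : PDvd p 1 (p : ℚ) := of_dvd (by simp)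

theorem self_pow (k : ℕ) : PDvd p k ((p : ℚ) ^ k) := by
  simpa using of_dvd (p := p) (k := k) (n := p ^ k) dvd_rfl

theorem cancel_pow {j k : ℕ} {x : ℚ} (h : PDvd p (j + k) ((p : ℚ) ^ j * x)) : PDvd p k x := by
  obtain ⟨a, b, hb, e⟩ := h
  refine ⟨a, b, hb, ?_⟩
  have : (p : ℚ) ^ j ≠ 0 := pow_ne_zero _ (by exact_mod_cast hp.out.ne_zero)
  apply mul_left_cancel₀ this
  rw [← mul_assoc, e, pow_add, mul_assoc]

theorem cancel {k n : ℕ} {x : ℚ} (hn : ¬ p ∣ n) (h : PDvd p k (n * x)) : PDvd p k x := by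
  have h0 := natCast_ne_zero hn
  have := (inv hn).mul_left h
  rwa [← mul_assoc, one_div, inv_mul_cancel₀ h0, one_mul] at this

end PDvd

section

variable {p : ℕ} [hp : Fact p.Prime]

theorem ratCong_of_PDvd {k : ℕ} {x y : ℚ} (h : PDvd p k (x - y)) : ratCong (p ^ k) x y := by
  rw [ratCong]
  generalize x - y = x at *
  obtain ⟨a, b, hb, e⟩ := h
  have hx : x.num * b = p ^ k * a * x.den := by
    have : (x.num : ℚ) = x * x.den := (Rat.mul_den_eq_num x).symm
    have h2 : (x.num : ℚ) * b = p ^ k * a * x.den := by rw [this, ← e]; ring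
    exact_mod_cast h2
  have hpp := Nat.prime_iff_prime_int.1 hp.out
  have hden : ¬ p ∣ x.den := by
    intro hd
    have hd' : (p : ℤ) ∣ x.den := by exact_mod_cast hd
    have : (p : ℤ) ∣ x.num * b := hx ▸ Dvd.dvd.mul_left hd' _
    rcases hpp.dvd_or_dvd this with h | h
    · have h1 : p ∣ x.num.natAbs := Int.natCast_dvd.1 h
      have := Nat.dvd_gcd h1 hd
      rw [x.reduced] at this
      exact hp.out.one_lt.ne' (Nat.dvd_one.1 this)
    · exact hb h
  refine ⟨Nat.Coprime.pow_right _ (((Nat.Prime.coprime_iff_not_dvd hp.out).2 hden).symm), ?_⟩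
  have hc : IsCoprime ((p ^ k : ℕ) : ℤ) b := by
    push_cast
    exact IsCoprime.pow_left ((Prime.coprime_iff_not_dvd hpp).2 hb)
  apply hc.dvd_of_dvd_mul_right
  rw [hx]
  push_cast
  exact ⟨a * x.den, by ring⟩

theorem sum_range_mul_eq (f : ℕ → ℚ) (m L : ℕ) : ∑ t ∈ range (m * L), f t
    = ∑ u ∈ range m, ∑ s ∈ range L, f (u + m * s) := by
  induction L with
  | zero => simp
  | succ L ih =>
    rw [Nat.mul_succ, sum_range_add, ih, ← sum_add_distrib]
    refine sum_congr rfl fun u _ => ?_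
    rw [sum_range_succ, add_comm u]

/-- `p`-integral valued functions on `ℕ` that are `1`-Lipschitz for the `p`-adic metric. -/
structure PLip (p : ℕ) (g : ℕ → ℚ) : Prop where
  integral : ∀ t, PDvd p 0 (g t)
  lipschitz : ∀ j s t, PDvd p j (g (t + p ^ j * s) - g t)

theorem PLip.const {c : ℚ} (hc : PDvd p 0 c) : PLip p fun _ => c :=
  ⟨fun _ => hc, fun j _ _ => by simpa using PDvd.zero j⟩

theorem PLip.natCast : PLip p fun t => (t : ℚ) :=
  ⟨fun t => PDvd.natCast t, fun j s t => by
    have := (PDvd.self_pow (p := p) j).mul_right (PDvd.natCast s)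
    simpa using this⟩

theorem PLip.mul {f g : ℕ → ℚ} (hf : PLip p f) (hg : PLip p g) : PLip p fun t => f t * g t :=
  ⟨fun t => (hf.integral t).mul_left (hg.integral t), fun j s t => by
    have := ((hf.lipschitz j s t).mul_right (hg.integral (t + p ^ j * s))).add
      ((hf.integral t).mul_left (hg.lipschitz j s t))
    convert this using 1
    ring⟩

theorem PLip.inv_affine {b m : ℕ} (hm : p ∣ m) (hb : ¬ p ∣ b) :
    PLip p fun t => 1 / ((b + m * t : ℕ) : ℚ) := by
  have hn : ∀ t, ¬ p ∣ b + m * t := fun t h => hb ((Nat.dvd_add_left (hm.mul_right t)).1 h)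
  refine ⟨fun t => PDvd.inv (hn t), fun j s t => ?_⟩
  have := (((PDvd.self_pow (p := p) j).mul_right (PDvd.natCast (m * s))).mul_right
    (PDvd.inv (hn t))).mul_right (PDvd.inv (hn (t + p ^ j * s)))
  convert this.neg using 1
  have h1 := PDvd.natCast_ne_zero (hn t)
  have h2 := PDvd.natCast_ne_zero (hn (t + p ^ j * s))
  field_simp
  push_cast
  ring

theorem PLip.mul_sum {g : ℕ → ℚ} (hg : PLip p g) (a : ℕ) :
    ∀ M, PDvd p a (p * ∑ t ∈ range (p ^ a * M), g t) := by
  induction a with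
  | zero => exact fun M => (PDvd.natCast p).mul_left (PDvd.sum _ fun i _ => hg.integral i)
  | succ a ih =>
    intro M
    have e : (p : ℚ) * ∑ t ∈ range (p ^ (a + 1) * M), g t =
        p * ∑ u ∈ range (p ^ a), ∑ s ∈ range (p * M), (g (u + p ^ a * s) - g u)
          + p * (M * (p * ∑ t ∈ range (p ^ a * 1), g t)) := by
      rw [pow_succ, mul_assoc, sum_range_mul_eq]
      simp only [sum_sub_distrib, sum_const, card_range, nsmul_eq_mul, ← Finset.mul_sum, mul_one]
      push_cast
      ring
    rw [e, add_comm a 1]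
    exact (PDvd.self.mul (PDvd.sum _ fun u _ => PDvd.sum _ fun s _ => hg.lipschitz a s u)).add
      (PDvd.self.mul ((PDvd.natCast M).mul_left (ih 1)))

theorem sum_affine_mod {q : ℕ} (hq : ¬ p ∣ q) (c : ℕ) (F : ℕ → ℚ) :
    ∑ t ∈ range p, F ((c + q * t) % p) = ∑ a ∈ range p, F a := by
  have hinj : Set.InjOn (fun t => (c + q * t) % p) (range p : Set ℕ) := by
    intro s hs t ht h
    have h1 : c + q * s ≡ c + q * t [MOD p] := h
    have h2 := Nat.ModEq.add_left_cancel' c h1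
    have h3 : s ≡ t [MOD p] :=
      Nat.ModEq.cancel_left_of_coprime ((Nat.Prime.coprime_iff_not_dvd hp.out).2 hq) h2
    simp only [coe_range, Set.mem_Iio] at hs ht
    exact Nat.ModEq.eq_of_lt_of_lt h3 hs ht
  have himg : (range p).image (fun t => (c + q * t) % p) = range p := by
    apply Finset.eq_of_subset_of_card_le
    · intro x hx
      obtain ⟨t, -, rfl⟩ := mem_image.1 hx
      exact mem_range.2 (Nat.mod_lt _ hp.out.pos)
    · rw [card_image_of_injOn hinj]
  conv_rhs => rw [← himg]
  rw [sum_image hinj]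

end

section

variable {p : ℕ} [hp : Fact p.Prime]

theorem sum_range_cast (N : ℕ) : ∑ t ∈ range N, (t : ℚ) = N * (N - 1) / 2 := by
  induction N with
  | zero => simp
  | succ N ih => rw [sum_range_succ, ih]; push_cast; ring

theorem sum_range_sq_cast (N : ℕ) :
    ∑ t ∈ range N, (t : ℚ) ^ 2 = N * (N - 1) * (2 * N - 1) / 6 := by
  induction N with
  | zero => simp
  | succ N ih => rw [sum_range_succ, ih]; push_cast; ring

theorem not_dvd_two (hp2 : p ≠ 2) : ¬ p ∣ 2 := fun h =>
  hp2 ((Nat.prime_dvd_prime_iff_eq hp.out Nat.prime_two).1 h)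

theorem PDvd.cancel_two (hp2 : p ≠ 2) {k : ℕ} {x : ℚ} (h : PDvd p k (2 * x)) : PDvd p k x :=
  PDvd.cancel (not_dvd_two hp2) (by exact_mod_cast h)

theorem PDvd.sq_mul_sum {m N a : ℕ} {g : ℕ → ℚ} (hg : PLip p g) (hm : p ∣ m) (hN : p ^ a ∣ N) :
    PDvd p (a + 1) ((m : ℚ) ^ 2 * ∑ t ∈ range N, g t) := by
  obtain ⟨M, rfl⟩ := hm
  obtain ⟨L, rfl⟩ := hN
  have := ((PDvd.natCast M).pow 2).mul_left (PDvd.self.mul (hg.mul_sum a L))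
  rw [add_comm a 1]
  convert this using 1
  push_cast
  ring

omit hp in
theorem sum_inv_affine_eq {m b : ℕ} (N : ℕ) (hm : p ∣ m) (hb : ¬ p ∣ b) :
    ∑ t ∈ range N, 1 / ((b + m * t : ℕ) : ℚ) - (N / b - m * (N * (N - 1) / 2) / b ^ 2) =
      m ^ 2 * ∑ t ∈ range N, t * t * (1 / b) * (1 / b) * (1 / ((b + m * t : ℕ) : ℚ)) := by
  rw [← sum_range_cast, mul_sum, mul_sum, sum_div, sub_sub_eq_add_sub, sub_eq_iff_eq_add]
  have : (N / b : ℚ) = ∑ t ∈ range N, 1 / (b : ℚ) := by simp [div_eq_mul_inv]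
  rw [this, ← sum_add_distrib, ← sum_add_distrib]
  refine sum_congr rfl fun t _ => ?_
  have h1 := PDvd.natCast_ne_zero hb
  have h2 := PDvd.natCast_ne_zero (p := p) (b := b + m * t)
    fun h => hb ((Nat.dvd_add_left (hm.mul_right t)).1 h)
  field_simp
  push_cast
  ring

theorem sum_inv_affine {m b N a : ℕ} (hm : p ∣ m) (hb : ¬ p ∣ b) (hN : p ^ a ∣ N) :
    PDvd p (a + 1) (∑ t ∈ range N, 1 / ((b + m * t : ℕ) : ℚ)
      - (N / b - m * (N * (N - 1) / 2) / b ^ 2)) := by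
  rw [sum_inv_affine_eq N hm hb]
  refine PDvd.sq_mul_sum ?_ hm hN
  exact (((PLip.natCast.mul PLip.natCast).mul (PLip.const (PDvd.inv hb))).mul
    (PLip.const (PDvd.inv hb))).mul (PLip.inv_affine hm hb)

theorem three_mul_sum_inv_affine (hp2 : p ≠ 2) {m b N a : ℕ} (hm : p ∣ m) (hb : ¬ p ∣ b)
    (hN : p ^ a ∣ N) :
    PDvd p (a + 2) (3 * (∑ t ∈ range N, 1 / ((b + m * t : ℕ) : ℚ)
      - (N / b - m * (N * (N - 1) / 2) / b ^ 2))) := by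
  rw [sum_inv_affine_eq N hm hb]
  have h1 := PDvd.natCast_ne_zero hb
  have e : (3 : ℚ) * (m ^ 2 * ∑ t ∈ range N, t * t * (1 / b) * (1 / b) *
      (1 / ((b + m * t : ℕ) : ℚ))) =
      m ^ 2 * (N * (N - 1) * (2 * N - 1) / 2) * (1 / b) ^ 3
      - 3 * (m * (m ^ 2 * ∑ t ∈ range N, t * t * t * (1 / b) * (1 / b) * (1 / b) *
          (1 / ((b + m * t : ℕ) : ℚ)))) := by
    have e2 : (N * (N - 1) * (2 * N - 1) / 2 : ℚ) = 3 * ∑ t ∈ range N, (t : ℚ) ^ 2 := by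
      rw [sum_range_sq_cast]; ring
    rw [e2]
    simp only [mul_sum, sum_mul]
    rw [← sum_sub_distrib]
    refine sum_congr rfl fun t _ => ?_
    have h2 := PDvd.natCast_ne_zero (p := p) (b := b + m * t)
      fun h => hb ((Nat.dvd_add_left (hm.mul_right t)).1 h)
    field_simp
    push_cast
    ring
  rw [e]
  have hm1 : PDvd p 1 (m : ℚ) := PDvd.of_dvd (by simpa using hm)
  have hN1 : PDvd p a (N : ℚ) := PDvd.of_dvd hN
  refine PDvd.sub ?_ ?_
  · refine PDvd.mul_right ?_ ((PDvd.inv hb).pow 3)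
    apply PDvd.cancel_two hp2
    have := ((hN1.mul (hm1.mul hm1)).mul_right
      ((PDvd.natCast N).sub (PDvd.natCast 1))).mul_right
      (((PDvd.natCast 2).mul_left (PDvd.natCast N)).sub (PDvd.natCast 1))
    convert this using 1
    push_cast
    ring
  · have h3 := hm1.mul (PDvd.sq_mul_sum ((((((PLip.natCast (p := p).mul PLip.natCast).mul
      PLip.natCast).mul (PLip.const (PDvd.inv hb))).mul
      (PLip.const (PDvd.inv hb))).mul
      (PLip.const (PDvd.inv hb))).mul (PLip.inv_affine hm hb)) hm hN)
    have := (PDvd.natCast (p := p) 3).mul_left h3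
    rw [show a + 2 = 1 + (a + 1) by ring]
    exact_mod_cast this

/-- `1 / x` if `x` is divisible by neither `p` nor `q`, and `0` otherwise. -/
def invUnit (p q x : ℕ) : ℚ := if ¬ p ∣ x ∧ ¬ q ∣ x then 1 / (x : ℚ) else 0

/-- The sum of `1 / (i j)` over `i, j < n` with `i`, `j`, `i + j` prime to `p q`. -/
def pairSum (p q n : ℕ) : ℚ :=
  ∑ i ∈ range n, ∑ j ∈ range n,
    if ¬ p ∣ i + j ∧ ¬ q ∣ i + j then invUnit p q i * invUnit p q j else 0

theorem dvd_add_mul_iff {d m : ℕ} (h : d ∣ m) (b t : ℕ) : d ∣ b + m * t ↔ d ∣ b :=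
  Nat.dvd_add_left (h.mul_right t)

omit hp in
theorem invUnit_affine {q m : ℕ} (hpm : p ∣ m) (hqm : q ∣ m) (b t : ℕ) :
    invUnit p q (b + m * t) =
      if ¬ p ∣ b ∧ ¬ q ∣ b then 1 / ((b + m * t : ℕ) : ℚ) else 0 := by
  simp only [invUnit, dvd_add_mul_iff hpm, dvd_add_mul_iff hqm]

omit hp in
theorem pairSum_mul {q m N : ℕ} (hpm : p ∣ m) (hqm : q ∣ m) :
    pairSum p q (m * N) = ∑ b ∈ range m, ∑ c ∈ range m,
      if ¬ p ∣ b + c ∧ ¬ q ∣ b + c then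
        (∑ t ∈ range N, invUnit p q (b + m * t)) * ∑ t ∈ range N, invUnit p q (c + m * t)
      else 0 := by
  simp only [pairSum, sum_range_mul_eq]
  refine sum_congr rfl fun b _ => ?_
  rw [sum_comm]
  refine sum_congr rfl fun c _ => ?_
  have h : ∀ d, d ∣ m → ∀ s t, d ∣ b + m * s + (c + m * t) ↔ d ∣ b + c := fun d hd s t => by
    rw [show b + m * s + (c + m * t) = b + c + m * (s + t) by ring, dvd_add_mul_iff hd]
  simp only [h p hpm, h q hqm]
  split_ifs
  · rw [sum_mul_sum]
  · simp

end

section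

theorem sum_range_sub_eq {f : ℕ → ℚ} {n : ℕ} (h : f 0 = f n) :
    ∑ i ∈ range n, f (n - i) = ∑ i ∈ range n, f i := by
  have := sum_flip (n := n) f
  rw [sum_range_succ, sum_range_succ] at this
  simpa [h] using this

theorem dvd_iff_of_dvd_add {d a b : ℕ} (h : d ∣ a + b) : d ∣ a ↔ d ∣ b :=
  ⟨fun ha => (Nat.dvd_add_right ha).1 h, fun hb => (Nat.dvd_add_left hb).1 h⟩

theorem dvd_sub_iff {d n i : ℕ} (hd : d ∣ n) (hi : i ≤ n) : d ∣ n - i ↔ d ∣ i :=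
  dvd_iff_of_dvd_add (by rwa [Nat.sub_add_cancel hi])

theorem dvd_sub_add_sub_iff {d n i j : ℕ} (hd : d ∣ n) (hi : i ≤ n) (hj : j ≤ n) :
    d ∣ (n - i) + (n - j) ↔ d ∣ i + j := by
  refine dvd_iff_of_dvd_add ?_
  rw [show (n - i) + (n - j) + (i + j) = 2 * n by omega]
  exact hd.mul_left 2

theorem invUnit_of_dvd {p q x : ℕ} (h : p ∣ x) : invUnit p q x = 0 := by simp [invUnit, h]

variable {p : ℕ} [hp : Fact p.Prime]

theorem invUnit_integral (q x : ℕ) : PDvd p 0 (invUnit p q x) := by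
  unfold invUnit
  split_ifs with h
  · exact PDvd.inv h.1
  · exact PDvd.zero 0

theorem invUnit_sub {q n i k : ℕ} (hk : p ^ k ∣ n) (hpn : p ∣ n) (hqn : q ∣ n) (hi : i ≤ n) :
    PDvd p k (invUnit p q (n - i) + invUnit p q i) := by
  simp only [invUnit, dvd_sub_iff hpn hi, dvd_sub_iff hqn hi]
  split_ifs with h
  · have h1 : ¬ p ∣ n - i := by rw [dvd_sub_iff hpn hi]; exact h.1
    have := ((PDvd.of_dvd hk).mul_right (PDvd.inv h1)).mul_right (PDvd.inv h.1)
    convert this using 1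
    have h2 := PDvd.natCast_ne_zero h1
    have h3 := PDvd.natCast_ne_zero h.1
    field_simp
    rw [Nat.cast_sub hi]
    ring
  · simpa using PDvd.zero k

theorem pairSum_cubic (hp2 : p ≠ 2) {q m : ℕ} (hpm : p ∣ m) (hqm : q ∣ m) :
    PDvd p 1 (∑ b ∈ range m, ∑ c ∈ range m,
      if ¬ p ∣ b + c ∧ ¬ q ∣ b + c then
        invUnit p q b * invUnit p q c ^ 2 + invUnit p q b ^ 2 * invUnit p q c
      else 0) := by
  set v := invUnit p q with hv
  set F : ℕ → ℕ → ℚ := fun b c => if ¬ p ∣ b + c ∧ ¬ q ∣ b + c then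
        v b * v c ^ 2 + v b ^ 2 * v c else 0 with hF
  change PDvd p 1 (∑ b ∈ range m, ∑ c ∈ range m, F b c)
  have v0 : v 0 = 0 := invUnit_of_dvd (dvd_zero p)
  have vm : v m = 0 := invUnit_of_dvd hpm
  have e : ∑ b ∈ range m, ∑ c ∈ range m, F (m - b) (m - c) =
      ∑ b ∈ range m, ∑ c ∈ range m, F b c := by
    rw [sum_range_sub_eq (f := fun b => ∑ c ∈ range m, F b (m - c)) (by simp [hF, v0, vm])]
    refine sum_congr rfl fun b _ => ?_
    exact sum_range_sub_eq (by simp [hF, v0, vm])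
  apply PDvd.cancel_two hp2
  rw [two_mul]
  nth_rw 1 [← e]
  rw [← sum_add_distrib]
  refine PDvd.sum _ fun b hb => ?_
  rw [← sum_add_distrib]
  refine PDvd.sum _ fun c hc => ?_
  have hb' := (mem_range.1 hb).le
  have hc' := (mem_range.1 hc).le
  simp only [hF, dvd_sub_add_sub_iff hpm hb' hc', dvd_sub_add_sub_iff hqm hb' hc']
  split_ifs
  · have h1 : PDvd p 1 (v (m - b) + v b) := invUnit_sub (by simpa using hpm) hpm hqm hb'
    have h2 : PDvd p 1 (v (m - c) + v c) := invUnit_sub (by simpa using hpm) hpm hqm hc'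
    have i1 : ∀ x, PDvd p 0 (v x) := invUnit_integral q
    have := (((h1.mul_right (i1 (m - c))).mul_right (((i1 (m - c)).add (i1 (m - b))))).sub
      ((h2.mul_right (i1 b)).mul_right (((i1 (m - c)).add (i1 (m - b)))))).add
      (((h1.add h2).mul_right (i1 b)).mul_right (i1 c))
    convert this using 1
    ring
  · simpa using PDvd.zero (p := p) 1

theorem three_mul_pairSum_mul (hp2 : p ≠ 2) {q m N a : ℕ} (hpm : p ∣ m) (hqm : q ∣ m)
    (hN : p ^ a ∣ N) :
    PDvd p (2 * a + 2) (3 * pairSum p q (m * N) - 3 * (N ^ 2 * pairSum p q m)) := by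
  set v := invUnit p q with hv
  set H : ℕ → ℚ := fun b => ∑ t ∈ range N, invUnit p q (b + m * t) with hH
  set κ : ℚ := m * (N * (N - 1) / 2) with hκ
  set y : ℕ → ℚ := fun b => H b - (N * v b - κ * v b ^ 2) with hy
  have hN0 : PDvd p a (N : ℚ) := PDvd.of_dvd hN
  have hκ1 : PDvd p (a + 1) κ := by
    apply PDvd.cancel_two hp2
    have hm1 : PDvd p 1 (m : ℚ) := PDvd.of_dvd (by simpa using hpm)
    have := (hN0.mul hm1).mul_right ((PDvd.natCast N).sub (PDvd.natCast 1))
    convert this using 1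
    rw [hκ]
    push_cast
    ring
  have i1 : ∀ x, PDvd p 0 (v x) := invUnit_integral q
  have hy1 : ∀ b, PDvd p (a + 1) (y b) ∧ PDvd p (a + 2) (3 * y b) := by
    intro b
    simp only [hy, hH, hv, invUnit_affine hpm hqm]
    unfold invUnit
    split_ifs with h
    · have h1 := sum_inv_affine hpm h.1 hN
      have h2 := three_mul_sum_inv_affine hp2 hpm h.1 hN
      simpa [hκ, div_eq_mul_inv] using And.intro h1 h2
    · simpa using And.intro (PDvd.zero (p := p) (a + 1)) (PDvd.zero (a + 2))
  have e : 3 * pairSum p q (m * N) - 3 * (N ^ 2 * pairSum p q m) =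
      (∑ b ∈ range m, ∑ c ∈ range m, if ¬ p ∣ b + c ∧ ¬ q ∣ b + c then
        (N * (v b * (3 * y c)) + N * (v c * (3 * y b))
          + 3 * ((-κ * v b ^ 2 + y b) * (-κ * v c ^ 2 + y c))) else 0)
      - 3 * (N * κ * ∑ b ∈ range m, ∑ c ∈ range m, if ¬ p ∣ b + c ∧ ¬ q ∣ b + c then
        v b * v c ^ 2 + v b ^ 2 * v c else 0) := by
    rw [pairSum_mul hpm hqm, pairSum]
    have hHb : ∀ b, ∑ t ∈ range N, v (b + m * t) = H b := fun _ => rfl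
    simp only [← hv, hHb]
    simp only [mul_sum, ← sum_sub_distrib]
    refine sum_congr rfl fun b _ => sum_congr rfl fun c _ => ?_
    split_ifs
    · simp only [hy]
      ring
    · ring
  rw [e]
  refine PDvd.sub ?_ ?_
  · refine PDvd.sum _ fun b _ => PDvd.sum _ fun c _ => ?_
    split_ifs
    · have h1 := hN0.mul ((i1 b).mul_left (hy1 c).2)
      have h2 := hN0.mul ((i1 c).mul_left (hy1 b).2)
      have h3 : ∀ x, PDvd p (a + 1) (-κ * v x ^ 2 + y x) := fun x =>
        (hκ1.neg.mul_right ((i1 x).pow 2)).add (hy1 x).1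
      have h4 := (PDvd.natCast (p := p) 3).mul_left ((h3 b).mul (h3 c))
      rw [show 2 * a + 2 = a + (a + 2) by ring]
      rw [show a + 1 + (a + 1) = a + (a + 2) by ring] at h4
      exact (h1.add h2).add (by exact_mod_cast h4)
    · exact PDvd.zero _
  · have := (PDvd.natCast (p := p) 3).mul_left ((hN0.mul hκ1).mul (pairSum_cubic hp2 hpm hqm))
    rw [show 2 * a + 2 = a + (a + 1) + 1 by ring]
    exact_mod_cast this

end

section

theorem sum_sum_dvd_add {n : ℕ} {f : ℕ → ℚ} (h0 : f 0 = 0) :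
    ∑ i ∈ range n, ∑ j ∈ range n, (if n ∣ i + j then f i * f j else 0)
      = ∑ i ∈ range n, f i * f (n - i) := by
  refine sum_congr rfl fun i hi => ?_
  have hi' := mem_range.1 hi
  rcases Nat.eq_zero_or_pos i with rfl | hpos
  · simp [h0]
  · rw [sum_eq_single_of_mem (n - i) (mem_range.2 (by omega))]
    · rw [if_pos (by rw [Nat.add_sub_cancel' hi'.le])]
    · intro j hj hne
      have hj' := mem_range.1 hj
      rw [if_neg]
      rintro ⟨k, hk⟩
      have : k < 2 := by
        by_contra h
        have := Nat.mul_le_mul_left n (not_lt.1 h)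
        omega
      interval_cases k <;> omega

theorem sum_sum_class {n N : ℕ} (f : ℕ → ℚ) (P : ℕ → Prop) [DecidablePred P]
    (hP : ∀ x t, P (x + n * t) ↔ P x) :
    ∑ i ∈ range (n * N), ∑ j ∈ range (n * N), (if P (i + j) then f i * f j else 0)
      = ∑ a ∈ range n, ∑ b ∈ range n, if P (a + b) then
        (∑ t ∈ range N, f (a + n * t)) * ∑ t ∈ range N, f (b + n * t) else 0 := by
  simp only [sum_range_mul_eq]
  refine sum_congr rfl fun b _ => ?_
  rw [sum_comm]
  refine sum_congr rfl fun c _ => ?_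
  have h : ∀ s t, P (b + n * s + (c + n * t)) ↔ P (b + c) := fun s t => by
    rw [show b + n * s + (c + n * t) = b + c + n * (s + t) by ring, hP]
  simp only [h]
  split_ifs
  · rw [sum_mul_sum]
  · simp

variable {p : ℕ} [hp : Fact p.Prime]

theorem PDvd.inv_sub_inv {k x y : ℕ} (hx : ¬ p ∣ x) (hy : ¬ p ∣ y) {c : ℚ} (hc : PDvd p 0 c)
    (h : (x : ℚ) - y = p ^ k * c) : PDvd p k (1 / (x : ℚ) - 1 / y) := by
  have := (((PDvd.self_pow (p := p) k).mul_right hc).mul_right (PDvd.inv hx)).mul_right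
    (PDvd.inv hy)
  rw [← h] at this
  convert this.neg using 1
  have h1 := PDvd.natCast_ne_zero hx
  have h2 := PDvd.natCast_ne_zero hy
  field_simp
  ring

theorem sum_inv_residues (hp2 : p ≠ 2) {q : ℕ} (hq : ¬ p ∣ q) (a : ℕ) :
    PDvd p 1 (∑ t ∈ range p, invUnit p q (a + q * t)) := by
  by_cases hqa : q ∣ a
  · have : ∀ t, invUnit p q (a + q * t) = 0 := fun t => by
      simp [invUnit, (dvd_add_mul_iff dvd_rfl a t).2 hqa]
    simpa [this] using PDvd.zero (p := p) 1
  · set w : ℕ → ℚ := fun x => if ¬ p ∣ x then 1 / (x : ℚ) else 0 with hw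
    have hw0 : PDvd p 1 (∑ x ∈ range p, w x) := by
      apply PDvd.cancel_two hp2
      rw [two_mul]
      nth_rw 1 [← sum_range_sub_eq (f := w) (n := p) (by simp [hw])]
      rw [← sum_add_distrib]
      refine PDvd.sum _ fun x hx => ?_
      have hx' := (mem_range.1 hx).le
      simp only [hw, dvd_sub_iff (dvd_refl p) hx']
      split_ifs with h
      · simpa using PDvd.zero (p := p) 1
      · have h1 : ¬ p ∣ p - x := by rwa [dvd_sub_iff (dvd_refl p) hx']
        have := (PDvd.self.mul_right (PDvd.inv h1)).mul_right (PDvd.inv h)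
        convert this using 1
        have h2 := PDvd.natCast_ne_zero h1
        have h3 := PDvd.natCast_ne_zero h
        field_simp
        rw [Nat.cast_sub hx']
        ring
    rw [← sum_affine_mod hq a w] at hw0
    have hd : PDvd p 1 (∑ t ∈ range p, (invUnit p q (a + q * t) - w ((a + q * t) % p))) := by
      refine PDvd.sum _ fun t _ => ?_
      have h1 : invUnit p q (a + q * t) = w (a + q * t) := by
        simp [invUnit, hw, (dvd_add_mul_iff dvd_rfl a t), hqa]
      rw [h1]
      generalize a + q * t = x
      simp only [hw, Nat.dvd_mod_iff (dvd_refl p)]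
      split_ifs with h
      · simpa using PDvd.zero (p := p) 1
      · refine PDvd.inv_sub_inv h (by rwa [Nat.dvd_mod_iff (dvd_refl p)])
          (PDvd.natCast (x / p)) ?_
        rw [pow_one, sub_eq_iff_eq_add']
        exact_mod_cast (Nat.mod_add_div x p).symm
    have := hd.add hw0
    rwa [sum_sub_distrib, sub_add_cancel] at this

/-- Restricting `pairSum` by the condition at `q` only. -/
theorem pairSum_not_dvd_right (hp2 : p ≠ 2) {q : ℕ} (hq : ¬ p ∣ q) :
    PDvd p 2 (∑ i ∈ range (p * q), ∑ j ∈ range (p * q),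
      if ¬ q ∣ i + j then invUnit p q i * invUnit p q j else 0) := by
  rw [mul_comm p q, sum_sum_class (invUnit p q) (fun x => ¬ q ∣ x)
    (fun x t => by rw [dvd_add_mul_iff dvd_rfl])]
  refine PDvd.sum _ fun a _ => PDvd.sum _ fun b _ => ?_
  split_ifs
  · exact PDvd.zero 2
  · exact (sum_inv_residues hp2 hq a).mul (sum_inv_residues hp2 hq b)

theorem class_sum {q a r t₀ : ℕ} (hpq : Nat.Coprime p q) (ha : ¬ p ∣ a) (ht : t₀ < q)
    (h : a + p * t₀ = q * r) :
    PDvd p 2 (∑ t ∈ range q, invUnit p q (a + p * t)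
      - (q / a - p * (q * (q - 1) / 2) / a ^ 2 - 1 / (q * r))) := by
  have h1 : ∑ t ∈ range q, invUnit p q (a + p * t) =
      ∑ t ∈ range q, 1 / ((a + p * t : ℕ) : ℚ) - 1 / (q * r) := by
    have h2 : ∑ t ∈ range q, (if q ∣ a + p * t then 1 / ((a + p * t : ℕ) : ℚ) else 0)
        = 1 / (q * r) := by
      rw [sum_eq_single_of_mem t₀ (mem_range.2 ht)]
      · rw [if_pos (by rw [h]; exact dvd_mul_right q r), h]
        push_cast
        rfl
      · intro t htq hne
        rw [if_neg]
        intro hd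
        apply hne
        have h3 : a + p * t ≡ a + p * t₀ [MOD q] := by
          rw [Nat.ModEq, Nat.mod_eq_zero_of_dvd hd, h, Nat.mul_mod_right]
        exact Nat.ModEq.eq_of_lt_of_lt (Nat.ModEq.cancel_left_of_coprime hpq.symm
          (Nat.ModEq.add_left_cancel' a h3)) (mem_range.1 htq) ht
    rw [← h2, ← sum_sub_distrib]
    refine sum_congr rfl fun t _ => ?_
    simp only [invUnit, dvd_add_mul_iff (dvd_refl p), ha, not_false_eq_true, true_and]
    split_ifs <;> simp_all
  have h3 := sum_inv_affine_eq q (dvd_refl p) ha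
  have h4 : PDvd p 2 ((p : ℚ) ^ 2 * ∑ t ∈ range q, t * t * (1 / a) * (1 / a) *
      (1 / ((a + p * t : ℕ) : ℚ))) := by
    refine (PDvd.self_pow 2).mul_right (PDvd.sum _ fun t _ => ?_)
    exact ((((PLip.natCast.mul PLip.natCast).mul (PLip.const (PDvd.inv ha))).mul
      (PLip.const (PDvd.inv ha))).mul (PLip.inv_affine (dvd_refl p) ha)).integral t
  rw [← h3] at h4
  rw [h1]
  convert h4 using 1
  ring

omit hp in
theorem class_linear_identity {p q a r : ℚ} (ha : a ≠ 0) (hr : r ≠ 0) (ha' : p - a ≠ 0)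
    (hr' : p - r ≠ 0) (hq : q ≠ 0) :
    (1 / a) ^ 2 * (q * (1 / (p - a)) - 1 / q * (1 / (p - r))) +
      (1 / (p - a)) ^ 2 * (q * (1 / a) - 1 / q * (1 / r)) =
    p * ((1 / a) ^ 2 * (q * (1 / a) * (1 / (p - a)) - (1 / q) * (1 / r) * (1 / (p - r)))
      + (p - 2 * (p - a)) * (1 / a) ^ 2 * (1 / (p - a)) ^ 2 *
        (q * (1 / a) - 1 / q * (1 / r))) := by
  field_simp
  ring

omit hp in
theorem class_product_identity {p q a r ε : ℚ} (ha : a ≠ 0) (hr : r ≠ 0) (ha' : p - a ≠ 0)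
    (hr' : p - r ≠ 0) (hq : q ≠ 0) (h : a = q * r - p * ε) :
    (q * (1 / a) - 1 / q * (1 / r)) * (q * (1 / (p - a)) - 1 / q * (1 / (p - r)))
      - ((q ^ 2 - q) * (1 / (a * (p - a))) + (1 / q ^ 2 - 1 / q) * (1 / (r * (p - r)))) =
    p ^ 2 * ((ε * q - ε - ε ^ 2) * (1 / q) * (1 / a) * (1 / (p - a)) * (1 / r) *
      (1 / (p - r))) := by
  field_simp
  subst h
  ring

theorem class_prod {q a r ε : ℕ} (hp2 : p ≠ 2) (hpq : Nat.Coprime p q) (hr0 : 0 < r) (hr : r < p)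
    (ha0 : 0 < a) (ha : a < p) (h : a + p * ε = q * r) :
    PDvd p 2 ((∑ t ∈ range q, invUnit p q (a + p * t)) *
        (∑ t ∈ range q, invUnit p q ((p - a) + p * t))
      - ((q ^ 2 - q) * (1 / (a * (p - a))) + (1 / q ^ 2 - 1 / q) * (1 / (r * (p - r))))) := by
  have hε : ε < q := by
    by_contra hc
    have := Nat.mul_le_mul_left p (not_lt.1 hc)
    nlinarith
  have hq : ¬ p ∣ q := (Nat.Prime.coprime_iff_not_dvd hp.out).1 hpq
  have nd : ∀ x, 0 < x → x < p → ¬ p ∣ x := fun x h1 h2 => Nat.not_dvd_of_pos_of_lt h1 h2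
  have dA := nd a ha0 ha
  have dA' := nd (p - a) (by omega) (by omega)
  have dR := nd r hr0 hr
  have dR' := nd (p - r) (by omega) (by omega)
  have h' : (p - a) + p * (q - 1 - ε) = q * (p - r) := by
    zify [ha.le, hr.le, show ε ≤ q - 1 by omega, show 1 ≤ q by omega]
    zify at h
    linear_combination -h
  have c1 := class_sum hpq dA hε h
  have c2 := class_sum hpq dA' (show q - 1 - ε < q by omega) h'
  set X := ∑ t ∈ range q, invUnit p q (a + p * t)
  set Y := ∑ t ∈ range q, invUnit p q ((p - a) + p * t)
  have hκ : PDvd p 0 ((q : ℚ) * (q - 1) / 2) := by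
    apply PDvd.cancel_two hp2
    have := (PDvd.natCast (p := p) q).mul_left ((PDvd.natCast q).sub (PDvd.natCast 1))
    convert this using 1
    push_cast
    ring
  set κ : ℚ := (q : ℚ) * (q - 1) / 2
  have iA := PDvd.inv dA
  have iA' := PDvd.inv dA'
  have iR := PDvd.inv dR
  have iR' := PDvd.inv dR'
  have iq := PDvd.inv hq
  have nA := PDvd.natCast_ne_zero dA
  have nA' := PDvd.natCast_ne_zero dA'
  have nR := PDvd.natCast_ne_zero dR
  have nR' := PDvd.natCast_ne_zero dR'
  have nq := PDvd.natCast_ne_zero hq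
  have eA : ((p - a : ℕ) : ℚ) = p - a := Nat.cast_sub ha.le
  have eR : ((p - r : ℕ) : ℚ) = p - r := Nat.cast_sub hr.le
  have iX : PDvd p 0 X := PDvd.sum _ fun t _ => invUnit_integral q _
  have zq := PDvd.natCast (p := p) q
  have zp := PDvd.natCast (p := p) p
  have zε := PDvd.natCast (p := p) ε
  have z1 : PDvd p 0 (1 : ℚ) := by exact_mod_cast PDvd.natCast (p := p) 1
  have i2 : PDvd p 0 (q * (1 / (a : ℚ)) - 1 / (q : ℚ) * (1 / r)) :=
    (zq.mul_left iA).sub (iq.mul_left iR)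
  have i3 : PDvd p 0 (q * (1 / ((p - a : ℕ) : ℚ)) - 1 / (q : ℚ) * (1 / ((p - r : ℕ) : ℚ))
      - p * κ * (1 / ((p - a : ℕ) : ℚ)) ^ 2) :=
    ((zq.mul_left iA').sub (iq.mul_left iR')).sub ((zp.mul_left hκ).mul_left (iA'.pow 2))
  have t1 := iX.mul_left c2
  have t2 := c1.mul_right i3
  have t3 : PDvd p 2 ((p : ℚ) ^ 2 * (κ * (1 / (a : ℚ)) ^ 2 * κ * (1 / ((p - a : ℕ) : ℚ)) ^ 2)) :=
    (PDvd.self_pow 2).mul_right (((hκ.mul_left (iA.pow 2)).mul_left hκ).mul_left (iA'.pow 2))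
  have t4 : PDvd p 2 ((p : ℚ) ^ 2 * (κ * ((1 / (a : ℚ)) ^ 2 *
      (q * (1 / a) * (1 / ((p - a : ℕ) : ℚ)) - (1 / q) * (1 / r) * (1 / ((p - r : ℕ) : ℚ)))
      + (p - 2 * ((p - a : ℕ) : ℚ)) * (1 / a) ^ 2 * (1 / ((p - a : ℕ) : ℚ)) ^ 2 *
        (q * (1 / (a : ℚ)) - 1 / (q : ℚ) * (1 / r))))) := by
    refine (PDvd.self_pow 2).mul_right (hκ.mul_left (PDvd.add ?_ ?_))
    · exact (iA.pow 2).mul_left (((zq.mul_left iA).mul_left iA').sub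
        ((iq.mul_left iR).mul_left iR'))
    · refine (PDvd.mul_left (PDvd.mul_left (zp.sub ?_) (iA.pow 2)) (iA'.pow 2)).mul_left i2
      exact_mod_cast (PDvd.natCast (p := p) 2).mul_left (PDvd.natCast (p - a))
  have t5 : PDvd p 2 ((p : ℚ) ^ 2 * ((ε * q - ε - ε ^ 2) * (1 / q) * (1 / a) *
      (1 / ((p - a : ℕ) : ℚ)) * (1 / r) * (1 / ((p - r : ℕ) : ℚ)))) := by
    refine (PDvd.self_pow 2).mul_right ?_
    exact ((((((zε.mul_left zq).sub zε).sub (zε.pow 2)).mul_left iq).mul_left iA).mul_left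
      iA').mul_left iR |>.mul_left iR'
  have key := (((t1.add t2).add t3).sub t4).add t5
  have hS := class_linear_identity (p := (p : ℚ)) (q := q) nA nR
    (by rw [← eA]; exact nA') (by rw [← eR]; exact nR') nq
  have hT := class_product_identity (p := (p : ℚ)) (ε := ε) (q := q) nA nR
    (by rw [← eA]; exact nA') (by rw [← eR]; exact nR') nq
    (by rw [eq_sub_iff_add_eq]; exact_mod_cast h)
  rw [← eA, ← eR] at hS hT
  convert key using 1
  rw [← eA, ← eR]
  linear_combination hT - p * κ * hS

end

/-- The sum of `1 / (a (p - a))` over `0 < a < p`. -/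
def reflSum (p : ℕ) : ℚ := ∑ a ∈ range p, 1 / ((a : ℚ) * (p - a))

section

variable {p : ℕ} [hp : Fact p.Prime]

theorem invUnit_zero_left (p q : ℕ) : invUnit p q 0 = 0 := invUnit_of_dvd (dvd_zero p)

theorem pairSum_dvd_left (hp2 : p ≠ 2) {q : ℕ} (hpq : Nat.Coprime p q) :
    PDvd p 2 ((∑ i ∈ range (p * q), ∑ j ∈ range (p * q),
      if p ∣ i + j then invUnit p q i * invUnit p q j else 0)
      - ((q ^ 2 - q) + (1 / q ^ 2 - 1 / q)) * reflSum p) := by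
  have hq : ¬ p ∣ q := (Nat.Prime.coprime_iff_not_dvd hp.out).1 hpq
  rw [sum_sum_class (invUnit p q) (fun x => p ∣ x)
    (fun x t => by rw [dvd_add_mul_iff dvd_rfl])]
  set h : ℕ → ℚ := fun a => ∑ t ∈ range q, invUnit p q (a + p * t) with hh
  have h0 : h 0 = 0 := sum_eq_zero fun t _ => invUnit_of_dvd (by simp)
  change PDvd p 2 ((∑ a ∈ range p, ∑ b ∈ range p, if p ∣ a + b then h a * h b else 0) - _)
  rw [sum_sum_dvd_add h0, add_mul]
  have e1 : ∑ a ∈ range p, h a * h (p - a) =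
      ∑ r ∈ range p, h ((0 + q * r) % p) * h (p - (0 + q * r) % p) :=
    (sum_affine_mod hq 0 fun a => h a * h (p - a)).symm
  have e2 : reflSum p = ∑ r ∈ range p,
      1 / (((((0 + q * r) % p : ℕ) : ℚ)) * (p - ((0 + q * r) % p : ℕ))) :=
    (sum_affine_mod hq 0 fun a => 1 / ((a : ℚ) * (p - a))).symm
  rw [e1]
  nth_rw 1 [e2]
  rw [reflSum, mul_sum, mul_sum, ← sum_add_distrib, ← sum_sub_distrib]
  refine PDvd.sum _ fun r hr => ?_
  have hr' := mem_range.1 hr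
  rw [zero_add]
  rcases Nat.eq_zero_or_pos r with rfl | hpos
  · simpa [h0] using PDvd.zero 2
  · refine class_prod (ε := q * r / p) hp2 hpq hpos hr' ?_ (Nat.mod_lt _ hp.out.pos)
      (Nat.mod_add_div _ _)
    apply Nat.pos_of_ne_zero
    intro hz
    rcases (Nat.Prime.dvd_mul hp.out).1 (Nat.dvd_of_mod_eq_zero hz) with h | h
    · exact hq h
    · exact Nat.not_dvd_of_pos_of_lt hpos hr' h

theorem inv_affine_first {a t : ℕ} (ha : ¬ p ∣ a) :
    PDvd p 2 (1 / ((a + p * t : ℕ) : ℚ) - (1 / a - p * t * (1 / a) ^ 2)) := by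
  have hn : ¬ p ∣ a + p * t := by rwa [dvd_add_mul_iff dvd_rfl]
  have := (PDvd.self_pow (p := p) 2).mul_right
    ((((PDvd.natCast t).pow 2).mul_left ((PDvd.inv ha).pow 2)).mul_left (PDvd.inv hn))
  convert this using 1
  have h1 := PDvd.natCast_ne_zero hn
  have h2 := PDvd.natCast_ne_zero ha
  field_simp
  push_cast
  ring

theorem class_refl_sum {q a : ℕ} (ha0 : 0 < a) (ha : a < p) :
    PDvd p 2 (∑ t ∈ range q, 1 / (((a + p * t : ℕ) : ℚ) * (p * q - (a + p * t : ℕ)))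
      - q * (1 / (a * (p - a)))) := by
  have dA : ¬ p ∣ a := Nat.not_dvd_of_pos_of_lt ha0 ha
  have dA' : ¬ p ∣ p - a := Nat.not_dvd_of_pos_of_lt (by omega) (by omega)
  have nA := PDvd.natCast_ne_zero dA
  have nA' := PDvd.natCast_ne_zero dA'
  have eA : ((p - a : ℕ) : ℚ) = p - a := Nat.cast_sub ha.le
  have hz : ∑ t ∈ range q, p * (1 / (a : ℚ)) ^ 2 * (1 / ((p - a : ℕ) : ℚ)) *
      ((t : ℚ) - (q - 1 - t)) = 0 := by
    rw [← mul_sum, sum_sub_distrib, sum_sub_distrib, sum_range_cast]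
    simp only [sum_const, card_range, nsmul_eq_mul]
    ring
  have e : (q : ℚ) * (1 / (a * (p - a))) = ∑ t ∈ range q, (1 / (a * (p - a) : ℚ) -
      p * (1 / (a : ℚ)) ^ 2 * (1 / ((p - a : ℕ) : ℚ)) * ((t : ℚ) - (q - 1 - t))) := by
    rw [sum_sub_distrib, hz]
    simp
  rw [e, ← sum_sub_distrib]
  refine PDvd.sum _ fun t ht => ?_
  have ht' := mem_range.1 ht
  obtain ⟨s, rfl⟩ : ∃ s, q = t + s + 1 := ⟨q - t - 1, by omega⟩
  have hc : ((p : ℚ) * (t + s + 1 : ℕ) - (a + p * t : ℕ)) = ((p - a) + p * s : ℕ) := by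
    push_cast [eA]
    ring
  have c1 := inv_affine_first (t := t) dA
  have c2 := inv_affine_first (t := s) dA'
  have i1 : PDvd p 0 (1 / ((a + p * t : ℕ) : ℚ)) :=
    PDvd.inv (by rwa [dvd_add_mul_iff dvd_rfl])
  have zt := PDvd.natCast (p := p) t
  have zs := PDvd.natCast (p := p) s
  have zp := PDvd.natCast (p := p) p
  have iA := PDvd.inv dA
  have iA' := PDvd.inv dA'
  have i2 : PDvd p 0 (1 / ((p - a : ℕ) : ℚ) - p * s * (1 / ((p - a : ℕ) : ℚ)) ^ 2) :=
    iA'.sub ((zp.mul_left zs).mul_left (iA'.pow 2))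
  have t1 := i1.mul_left c2
  have t2 := c1.mul_right i2
  have t3 := (PDvd.self_pow (p := p) 2).mul_right
    ((((zt.mul_left zs).mul_left (iA.pow 2)).mul_left (iA'.pow 2)).sub
      ((zs.mul_left (iA.pow 2)).mul_left (iA'.pow 2)))
  convert (t1.add t2).add t3 using 1
  rw [hc, ← eA, ← one_div_mul_one_div, ← one_div_mul_one_div]
  have hx : (p : ℚ) - a ≠ 0 := by rw [← eA]; exact nA'
  have k : (1 / (a : ℚ)) + 1 / ((p - a : ℕ) : ℚ) = p * (1 / a) * (1 / ((p - a : ℕ) : ℚ)) := by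
    rw [eA]; field_simp; ring
  have ht1 : ((t + s + 1 : ℕ) : ℚ) - 1 - t = s := by push_cast; ring
  rw [ht1]
  linear_combination (-p * s * (1 / a) * (1 / ((p - a : ℕ) : ℚ))) * k

theorem sum_refl_unit {q : ℕ} :
    PDvd p 2 ((∑ b ∈ range (p * q),
      if ¬ p ∣ b then 1 / ((b : ℚ) * (p * q - b)) else 0) - q * reflSum p) := by
  rw [sum_range_mul_eq, reflSum, mul_sum, ← sum_sub_distrib]
  refine PDvd.sum _ fun a ha => ?_
  simp only [dvd_add_mul_iff (dvd_refl p)]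
  rcases Nat.eq_zero_or_pos a with rfl | hpos
  · simpa using PDvd.zero 2
  · simp only [Nat.not_dvd_of_pos_of_lt hpos (mem_range.1 ha), not_false_eq_true, if_true]
    exact class_refl_sum hpos (mem_range.1 ha)

omit hp in
theorem sum_refl_mul {q : ℕ} (hpq : Nat.Coprime p q) (hq0 : 0 < q) :
    (∑ b ∈ range (p * q), if ¬ p ∣ b ∧ q ∣ b then 1 / ((b : ℚ) * (p * q - b)) else 0)
      = 1 / q ^ 2 * reflSum p := by
  rw [mul_comm p q, sum_range_mul_eq, sum_eq_single_of_mem 0 (mem_range.2 hq0), reflSum, mul_sum]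
  · refine sum_congr rfl fun s hs => ?_
    have hs' := mem_range.1 hs
    rcases Nat.eq_zero_or_pos s with rfl | hpos
    · simp
    · have h1 : ¬ p ∣ 0 + q * s := by
        rw [zero_add, hpq.dvd_mul_left]
        exact Nat.not_dvd_of_pos_of_lt hpos hs'
      rw [if_pos ⟨h1, by simp⟩]
      have h2 : (q : ℚ) ≠ 0 := by exact_mod_cast hq0.ne'
      have h3 : (s : ℚ) ≠ 0 := by exact_mod_cast hpos.ne'
      have h4 : (p : ℚ) - s ≠ 0 := sub_ne_zero.2 (by exact_mod_cast hs'.ne')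
      rw [one_div_mul_one_div]
      congr 1
      push_cast
      ring
  · intro u hu hne
    refine sum_eq_zero fun s _ => if_neg fun h => ?_
    rw [dvd_add_mul_iff dvd_rfl] at h
    exact Nat.not_dvd_of_pos_of_lt (Nat.pos_of_ne_zero hne) (mem_range.1 hu) h.2

theorem pairSum_dvd_both {q : ℕ} (hpq : Nat.Coprime p q) (hq0 : 0 < q) :
    PDvd p 2 ((∑ i ∈ range (p * q), ∑ j ∈ range (p * q),
      if p ∣ i + j ∧ q ∣ i + j then invUnit p q i * invUnit p q j else 0)
      - (q - 1 / q ^ 2) * reflSum p) := by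
  have hd : ∀ x, p ∣ x ∧ q ∣ x ↔ p * q ∣ x := fun x =>
    ⟨fun h => hpq.mul_dvd_of_dvd_of_dvd h.1 h.2,
      fun h => ⟨(dvd_mul_right p q).trans h, (dvd_mul_left q p).trans h⟩⟩
  simp only [hd]
  rw [sum_sum_dvd_add (invUnit_zero_left p q), sub_mul, ← sum_refl_mul hpq hq0]
  convert sum_refl_unit (p := p) (q := q) using 1
  rw [sub_sub_eq_add_sub, ← sum_add_distrib]
  congr 1
  refine sum_congr rfl fun b hb => ?_
  have hb' := (mem_range.1 hb).le
  simp only [invUnit, dvd_sub_iff (dvd_mul_right p q) hb', dvd_sub_iff (dvd_mul_left q p) hb']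
  have e : ((p * q - b : ℕ) : ℚ) = p * q - b := by rw [Nat.cast_sub hb']; push_cast; rfl
  rw [e]
  by_cases h1 : p ∣ b <;> by_cases h2 : q ∣ b <;> simp [h1, h2, mul_comm]

theorem pairSum_base (hp2 : p ≠ 2) {q : ℕ} (hpq : Nat.Coprime p q) (hq0 : 0 < q) :
    PDvd p 2 (pairSum p q (p * q) - q * (2 - q) * (1 - 1 / q ^ 3) * reflSum p) := by
  have hq : ¬ p ∣ q := (Nat.Prime.coprime_iff_not_dvd hp.out).1 hpq
  have h := ((pairSum_not_dvd_right hp2 hq).sub (pairSum_dvd_left hp2 hpq)).add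
    (pairSum_dvd_both hpq hq0)
  have e : pairSum p q (p * q) =
      (∑ i ∈ range (p * q), ∑ j ∈ range (p * q),
        if ¬ q ∣ i + j then invUnit p q i * invUnit p q j else 0)
      - (∑ i ∈ range (p * q), ∑ j ∈ range (p * q),
        if p ∣ i + j then invUnit p q i * invUnit p q j else 0)
      + ∑ i ∈ range (p * q), ∑ j ∈ range (p * q),
        if p ∣ i + j ∧ q ∣ i + j then invUnit p q i * invUnit p q j else 0 := by
    simp only [pairSum, ← sum_sub_distrib, ← sum_add_distrib]
    refine sum_congr rfl fun i _ => sum_congr rfl fun j _ => ?_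
    by_cases h1 : p ∣ i + j <;> by_cases h2 : q ∣ i + j <;> simp [h1, h2]
  convert h using 1
  rw [e]
  have h2 : (q : ℚ) ≠ 0 := by exact_mod_cast hq0.ne'
  field_simp
  ring

end

section

variable {p : ℕ} [hp : Fact p.Prime]

theorem bernoulli_integral (i : ℕ) (hi : i + 1 < p) : PDvd p 0 (bernoulli i) := by
  induction i using Nat.strong_induction_on with
  | _ i ih =>
    have h := sum_bernoulli (i + 1)
    rw [sum_range_succ, Nat.choose_succ_self_right] at h
    have h1 : PDvd p 0 (∑ k ∈ range i, ((i + 1).choose k : ℚ) * bernoulli k) :=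
      PDvd.sum _ fun k hk => (PDvd.natCast _).mul_left
        (ih k (mem_range.1 hk) (by have := mem_range.1 hk; omega))
    have h2 : PDvd p 0 (if i + 1 = 1 then (1 : ℚ) else 0) := by
      split_ifs
      · exact_mod_cast PDvd.natCast (p := p) 1
      · exact PDvd.zero 0
    refine PDvd.cancel (n := i + 1) (Nat.not_dvd_of_pos_of_lt (by omega) hi) ?_
    rw [← eq_sub_iff_add_eq'] at h
    rw [h]
    exact h2.sub h1

theorem sum_pow_sub_bernoulli {m : ℕ} (hm : m + 1 < p) :
    PDvd p 2 (∑ k ∈ range p, (k : ℚ) ^ m - p * bernoulli m) := by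
  have hd : ¬ p ∣ m + 1 := Nat.not_dvd_of_pos_of_lt (by omega) hm
  have hn : (m : ℚ) + 1 ≠ 0 := by positivity
  rw [sum_range_pow, sum_range_succ]
  have e : bernoulli m * ((m + 1).choose m) * (p : ℚ) ^ (m + 1 - m) / (m + 1) =
      p * bernoulli m := by
    rw [Nat.choose_succ_self_right, Nat.add_sub_cancel_left]
    push_cast
    field_simp
  rw [e, add_sub_cancel_right]
  refine PDvd.sum _ fun i hi => ?_
  have hi' := mem_range.1 hi
  rw [div_eq_mul_one_div]
  refine PDvd.mul_right (PDvd.mul_left ?_ ?_) ?_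
  · exact (bernoulli_integral i (by omega)).mul_left (PDvd.natCast _)
  · exact (PDvd.self_pow _).mono (by omega)
  · exact_mod_cast PDvd.inv hd

omit hp in
theorem exists_add_pow_succ (x d : ℤ) (n : ℕ) :
    ∃ z : ℤ, (x + d) ^ (n + 1) = x ^ (n + 1) + (n + 1) * d * x ^ n + d ^ 2 * z := by
  induction n with
  | zero => exact ⟨0, by simp⟩
  | succ n ih =>
    obtain ⟨z, hz⟩ := ih
    refine ⟨(n + 1) * x ^ n + z * (x + d), ?_⟩
    rw [pow_succ, hz]
    push_cast
    ring

theorem fermat_sub_one {x : ℕ} (hx : ¬ p ∣ x) : PDvd p 1 ((x : ℚ) ^ (p - 1) - 1) := by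
  have h : (p : ℤ) ∣ (x : ℤ) ^ (p - 1) - 1 := by
    rw [← Int.modEq_iff_dvd.trans (Iff.rfl : _ ↔ (p : ℤ) ∣ (x : ℤ) ^ (p - 1) - 1)]
    exact (Int.ModEq.pow_card_sub_one_eq_one hp.out
      (Nat.isCoprime_iff_coprime.2 ((Nat.Prime.coprime_iff_not_dvd hp.out).2 hx).symm)).symm
  obtain ⟨k, hk⟩ := h
  have := (PDvd.self (p := p)).mul_right (PDvd.intCast k)
  convert this using 1
  exact_mod_cast hk

theorem reflSum_add_sum_inv_sq (hp2 : p ≠ 2) :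
    PDvd p 2 (reflSum p + ∑ a ∈ range p, 1 / (a : ℚ) ^ 2) := by
  set f : ℕ → ℚ := fun a => 1 / ((a : ℚ) ^ 2 * (p - a)) with hf
  have e : reflSum p + ∑ a ∈ range p, 1 / (a : ℚ) ^ 2 = p * ∑ a ∈ range p, f a := by
    rw [reflSum, ← sum_add_distrib, mul_sum]
    refine sum_congr rfl fun a ha => ?_
    rcases Nat.eq_zero_or_pos a with rfl | hpos
    · simp [hf]
    · have h1 : (a : ℚ) ≠ 0 := by exact_mod_cast hpos.ne'
      have h2 : (p : ℚ) - a ≠ 0 := sub_ne_zero.2 (by exact_mod_cast (mem_range.1 ha).ne')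
      simp only [hf]
      field_simp
      ring
  rw [e]
  refine PDvd.self.mul (k := 1) ?_
  apply PDvd.cancel_two hp2
  rw [two_mul]
  nth_rw 1 [← sum_range_sub_eq (f := f) (n := p) (by simp [hf])]
  rw [← sum_add_distrib]
  refine PDvd.sum _ fun a ha => ?_
  have ha' := mem_range.1 ha
  rcases Nat.eq_zero_or_pos a with rfl | hpos
  · simpa [hf] using PDvd.zero 1
  · have d1 : ¬ p ∣ a := Nat.not_dvd_of_pos_of_lt hpos ha'
    have d2 : ¬ p ∣ p - a := Nat.not_dvd_of_pos_of_lt (by omega) (by omega)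
    have := PDvd.self.mul_right (((PDvd.inv d1).pow 2).mul_left ((PDvd.inv d2).pow 2))
    convert this using 1
    have n1 := PDvd.natCast_ne_zero d1
    have n2 := PDvd.natCast_ne_zero d2
    have e2 : ((p - a : ℕ) : ℚ) = p - a := Nat.cast_sub ha'.le
    rw [e2] at n2
    simp only [hf, e2, sub_sub_cancel]
    field_simp
    ring

theorem double_mod {r : ℕ} (hp2 : p ≠ 2) (hr0 : 0 < r) (hr : r < p) :
    ¬ p ∣ 2 * r ∧ ¬ p ∣ 2 * r % p := by
  have h : ¬ p ∣ 2 * r := fun h =>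
    ((Nat.Prime.dvd_mul hp.out).1 h).elim (not_dvd_two hp2) (Nat.not_dvd_of_pos_of_lt hr0 hr)
  exact ⟨h, by rwa [Nat.dvd_mod_iff dvd_rfl]⟩

/-- The Voronoi-type sum attached to multiplication by `2`. -/
def voronoiSum (p : ℕ) : ℚ := ∑ r ∈ range p, ((2 * r / p : ℕ) : ℚ) / (r : ℚ) ^ 3

theorem three_mul_sum_inv_sq (hp2 : p ≠ 2) :
    PDvd p 2 (3 * ∑ a ∈ range p, 1 / (a : ℚ) ^ 2 - p * voronoiSum p) := by
  have e : ∑ a ∈ range p, 1 / (a : ℚ) ^ 2 =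
      ∑ r ∈ range p, 1 / (((0 + 2 * r) % p : ℕ) : ℚ) ^ 2 :=
    (sum_affine_mod (not_dvd_two hp2) 0 fun a => 1 / (a : ℚ) ^ 2).symm
  have h : PDvd p 2 (∑ r ∈ range p, (4 * (1 / (((0 + 2 * r) % p : ℕ) : ℚ) ^ 2) - 1 / (r : ℚ) ^ 2
      - p * (((2 * r / p : ℕ) : ℚ) / (r : ℚ) ^ 3))) := by
    refine PDvd.sum _ fun r hr => ?_
    rw [zero_add]
    rcases Nat.eq_zero_or_pos r with rfl | hpos
    · simpa using PDvd.zero (p := p) 2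
    · obtain ⟨d1, d2⟩ := double_mod hp2 hpos (mem_range.1 hr)
      have hm : ((2 * r % p : ℕ) : ℚ) = 2 * r - p * (2 * r / p : ℕ) := by
        rw [eq_sub_iff_add_eq]
        exact_mod_cast Nat.mod_add_div (2 * r) p
      have n1 : (r : ℚ) ≠ 0 := by exact_mod_cast hpos.ne'
      have n2 := PDvd.natCast_ne_zero d2
      have z := PDvd.natCast (p := p) (2 * r / p)
      have zr := PDvd.natCast (p := p) r
      have key := (((PDvd.self_pow (p := p) 2).mul_right
        (((PDvd.natCast 4).mul_left (z.pow 2)).mul_left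
        (((PDvd.natCast 6).mul_left zr).sub (((PDvd.natCast 2).mul_left
          (PDvd.natCast p)).mul_left z)))).mul_right ((PDvd.inv d1).pow 3)).mul_right
          ((PDvd.inv d2).pow 2)
      convert key using 1
      generalize 2 * r / p = ε at *
      generalize 2 * r % p = a at *
      push_cast
      field_simp
      rw [hm]
      ring
  rw [sum_sub_distrib, sum_sub_distrib, ← mul_sum, ← mul_sum, ← e] at h
  convert h using 1
  rw [voronoiSum]
  ring

theorem two_mul_sum_pow (hp5 : 5 ≤ p) :
    PDvd p 2 (2 * ∑ a ∈ range p, (a : ℚ) ^ (p - 3) - p * voronoiSum p) := by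
  have hp2 : p ≠ 2 := by omega
  obtain ⟨n, hn⟩ : ∃ n, p = n + 5 := ⟨p - 5, by omega⟩
  have hpn : p - 3 = n + 1 + 1 := by omega
  have hG := sum_pow_sub_bernoulli (p := p) (m := p - 3) (by omega)
  have hG1 : PDvd p 1 (∑ a ∈ range p, (a : ℚ) ^ (p - 3)) := by
    have := (hG.mono one_le_two).add
      (PDvd.self.mul_right (bernoulli_integral (p := p) (p - 3) (by omega)))
    simpa using this
  have e : ∑ a ∈ range p, (a : ℚ) ^ (p - 3) =
      ∑ r ∈ range p, (((0 + 2 * r) % p : ℕ) : ℚ) ^ (p - 3) :=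
    (sum_affine_mod (not_dvd_two hp2) 0 fun a => (a : ℚ) ^ (p - 3)).symm
  have h : PDvd p 2 (∑ r ∈ range p, (8 * (((0 + 2 * r) % p : ℕ) : ℚ) ^ (p - 3)
      - 8 * (2 ^ (p - 3) * (r : ℚ) ^ (p - 3))
      - 3 * (p * (((2 * r / p : ℕ) : ℚ) / (r : ℚ) ^ 3)))) := by
    refine PDvd.sum _ fun r hr => ?_
    rw [zero_add]
    rcases Nat.eq_zero_or_pos r with rfl | hpos
    · simpa [hpn] using PDvd.zero (p := p) 2
    · obtain ⟨d1, d2⟩ := double_mod hp2 hpos (mem_range.1 hr)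
      have dr := Nat.not_dvd_of_pos_of_lt hpos (mem_range.1 hr)
      have hm : ((2 * r % p : ℕ) : ℤ) = 2 * r + -(p * (2 * r / p : ℕ)) := by
        rw [← sub_eq_add_neg, eq_sub_iff_add_eq]
        exact_mod_cast Nat.mod_add_div (2 * r) p
      have n1 : (r : ℚ) ≠ 0 := by exact_mod_cast hpos.ne'
      have hf := fermat_sub_one d1
      generalize 2 * r / p = ε at *
      generalize 2 * r % p = s at *
      obtain ⟨z, hz⟩ := exists_add_pow_succ (2 * r) (-(p * ε)) (n + 1)
      rw [← hm] at hz
      have hz' : (s : ℚ) ^ (n + 1 + 1) = (2 * r) ^ (n + 1 + 1) +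
          ((n + 1 : ℕ) + 1) * (-(p * ε)) * (2 * r) ^ (n + 1) +
          (-(p * ε)) ^ 2 * z := by exact_mod_cast hz
      have t1 := (PDvd.self_pow (p := p) 2).mul_right
        (((PDvd.natCast 8).mul_left ((PDvd.natCast ε).pow 2)).mul_left (PDvd.intCast z))
      have t2 := (PDvd.self_pow (p := p) 2).mul_right
        (((PDvd.natCast 8).mul_left (PDvd.natCast ε)).mul_left
          ((PDvd.natCast (2 * r)).pow (n + 1)))
      have t3 := ((PDvd.self (p := p)).mul hf).mul_right
        (((PDvd.natCast 3).mul_left (PDvd.natCast ε)).mul_left ((PDvd.inv dr).pow 3))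
      convert (t1.sub t2).add t3 using 1
      rw [hpn, hz', show p - 1 = n + 1 + 3 by omega]
      have hpq : (p : ℚ) = n + 5 := by exact_mod_cast hn
      push_cast
      rw [pow_add _ (n + 1) 3, pow_succ _ (n + 1), ← mul_pow, pow_succ _ (n + 1)]
      generalize ((2 * r : ℚ)) ^ (n + 1) = X
      have hnq : (n : ℚ) = p - 5 := by rw [hpq]; ring
      rw [hnq]
      field_simp
      ring
  rw [sum_sub_distrib, sum_sub_distrib, ← mul_sum, ← mul_sum, ← mul_sum, ← mul_sum, ← mul_sum,
    ← e] at h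
  have hf := (fermat_sub_one (p := p) (not_dvd_two hp2)).mul hG1
  have h3 : ¬ p ∣ 3 := Nat.not_dvd_of_pos_of_lt (by omega) (by omega)
  refine PDvd.cancel h3 ?_
  have := h.add ((PDvd.natCast (p := p) 2).mul_left hf)
  convert this using 1
  rw [voronoiSum, show p - 1 = p - 3 + 2 by omega, pow_add]
  push_cast
  ring

theorem three_mul_reflSum (hp2 : p ≠ 2) :
    PDvd p 2 (3 * reflSum p + 2 * p * bernoulli (p - 3)) := by
  rcases Nat.lt_or_ge p 5 with h | h
  · have h3 : p = 3 := by
      have := hp.out.two_le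
      interval_cases p
      · exact absurd rfl hp2
      · rfl
      · exact absurd hp.out (by norm_num)
    subst h3
    refine ⟨1, 1, by norm_num, ?_⟩
    norm_num [reflSum, sum_range_succ]
  · have h1 := (PDvd.natCast (p := p) 3).mul_left (reflSum_add_sum_inv_sq hp2)
    have h2 := three_mul_sum_inv_sq hp2
    have h3 := two_mul_sum_pow h
    have h4 := (PDvd.natCast (p := p) 2).mul_left
      (sum_pow_sub_bernoulli (p := p) (m := p - 3) (by omega))
    convert ((h1.sub h2).add h3).sub h4 using 1
    push_cast
    ring

end

section

/-- The sum of `1 / (ijk)` over residues `i, j, k` prime to `p` and `q` with sum `s`. -/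
def tripleSum (p q n s : ℕ) : ℚ :=
  ∑ i ∈ range n, ∑ j ∈ range n, ∑ k ∈ range n,
    if i + j + k = s then invUnit p q i * invUnit p q j * invUnit p q k else 0

theorem natCast_mul_invUnit {p q x : ℕ} :
    (x : ℚ) * invUnit p q x = if ¬ p ∣ x ∧ ¬ q ∣ x then 1 else 0 := by
  unfold invUnit
  split_ifs with h
  · have := PDvd.natCast_ne_zero h.1
    field_simp
  · simp

theorem sum_range_collapse {p q n i j : ℕ} (hpn : p ∣ n) (hqn : q ∣ n) (hi : i < n) (hj : j < n) :
    ∑ k ∈ range n, (if i + j + k = n ∨ i + j + k = 2 * n then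
      k * (invUnit p q i * invUnit p q j * invUnit p q k) else 0) =
    if ¬ p ∣ i + j ∧ ¬ q ∣ i + j then invUnit p q i * invUnit p q j else 0 := by
  rcases Nat.eq_zero_or_pos i with rfl | hi0
  · simp [invUnit_of_dvd (dvd_zero p)]
  obtain ⟨k₀, hk₀, h⟩ : ∃ k₀ < n, i + j + k₀ = n ∨ i + j + k₀ = 2 * n := by
    rcases le_or_gt (i + j) n with h | h
    · exact ⟨n - (i + j), by omega, by omega⟩
    · exact ⟨2 * n - (i + j), by omega, by omega⟩
  have hd : ∀ d, d ∣ n → (d ∣ k₀ ↔ d ∣ i + j) := fun d hd =>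
    (dvd_iff_of_dvd_add (by
      rcases h with h | h <;> rw [h]
      · exact hd
      · exact hd.mul_left 2)).symm
  rw [sum_eq_single k₀ (fun k hk hne => if_neg (by have := mem_range.1 hk; omega))
    (fun hk => absurd (mem_range.2 hk₀) hk), if_pos h, mul_left_comm, natCast_mul_invUnit,
    mul_ite, mul_one, mul_zero]
  simp only [hd p hpn, hd q hqn]

theorem natCast_mul_tripleSum_add {p q n : ℕ} (hpn : p ∣ n) (hqn : q ∣ n) (hn : 0 < n) :
    n * (tripleSum p q n n + 2 * tripleSum p q n (2 * n)) = 3 * pairSum p q n := by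
  set v := invUnit p q with hv
  set g : ℕ → ℕ → ℕ → ℚ := fun i j k =>
    if i + j + k = n ∨ i + j + k = 2 * n then v i * v j * v k else 0 with hg
  have e1 : n * (tripleSum p q n n + 2 * tripleSum p q n (2 * n)) =
      ∑ i ∈ range n, ∑ j ∈ range n, ∑ k ∈ range n, (i * g i j k + j * g i j k + k * g i j k) := by
    simp only [tripleSum, mul_add, mul_sum, ← sum_add_distrib]
    refine sum_congr rfl fun i _ => sum_congr rfl fun j _ => sum_congr rfl fun k _ => ?_
    rw [← add_mul, ← add_mul]
    simp only [hg, ← hv]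
    by_cases h1 : i + j + k = n
    · have : i + j + k ≠ 2 * n := by omega
      have hq : (n : ℚ) = i + j + k := by rw [← h1]; push_cast; ring
      rw [if_pos h1, if_neg this, if_pos (Or.inl h1), hq]
      ring
    · by_cases h2 : i + j + k = 2 * n
      · have hq : 2 * (n : ℚ) = i + j + k := by exact_mod_cast h2.symm
        rw [if_neg h1, if_pos h2, if_pos (Or.inr h2), ← hq]
        ring
      · simp [h1, h2]
  have hk : ∑ i ∈ range n, ∑ j ∈ range n, ∑ k ∈ range n, k * g i j k = pairSum p q n := by
    refine sum_congr rfl fun i hi => sum_congr rfl fun j hj => ?_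
    rw [← sum_range_collapse hpn hqn (mem_range.1 hi) (mem_range.1 hj)]
    simp only [hg, mul_ite, mul_zero, hv]
  have hj : ∑ i ∈ range n, ∑ j ∈ range n, ∑ k ∈ range n, j * g i j k = pairSum p q n := by
    rw [← hk]
    refine sum_congr rfl fun i _ => ?_
    rw [sum_comm]
    refine sum_congr rfl fun j _ => sum_congr rfl fun k _ => ?_
    simp only [hg, add_right_comm i k j, mul_right_comm (v i) (v k) (v j)]
  have hi : ∑ i ∈ range n, ∑ j ∈ range n, ∑ k ∈ range n, i * g i j k = pairSum p q n := by
    rw [← hj, sum_comm]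
    refine sum_congr rfl fun i _ => sum_congr rfl fun j _ => sum_congr rfl fun k _ => ?_
    simp only [hg, add_comm j i, mul_comm (v j) (v i)]
  rw [e1]
  simp only [sum_add_distrib]
  rw [hi, hj, hk]
  ring

theorem Z_eq_tripleSum {p q n : ℕ} (h : ∀ x, Nat.Coprime x n ↔ ¬ p ∣ x ∧ ¬ q ∣ x) (hpn : p ∣ n) :
    Z n = tripleSum p q n n := by
  have hI : ∀ f : ℕ → ℚ, f 0 = 0 → f n = 0 → ∑ i ∈ Icc 1 n, f i = ∑ i ∈ range n, f i := by
    intro f h0 hn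
    have e : range (n + 1) = insert 0 (Icc 1 n) := by ext; simp; omega
    have := sum_range_succ f n
    rw [e, sum_insert (by simp), h0, hn, zero_add, add_zero] at this
    exact this
  have v0 : invUnit p q 0 = 0 := invUnit_of_dvd (dvd_zero p)
  have vn : invUnit p q n = 0 := invUnit_of_dvd hpn
  have e : Z n = ∑ i ∈ Icc 1 n, ∑ j ∈ Icc 1 n, ∑ k ∈ Icc 1 n,
      if i + j + k = n then invUnit p q i * invUnit p q j * invUnit p q k else 0 := by
    refine sum_congr rfl fun i _ => sum_congr rfl fun j _ => sum_congr rfl fun k _ => ?_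
    simp only [h, invUnit]
    by_cases hs : i + j + k = n
    · by_cases hi : ¬ p ∣ i ∧ ¬ q ∣ i <;> by_cases hj : ¬ p ∣ j ∧ ¬ q ∣ j <;>
        by_cases hk : ¬ p ∣ k ∧ ¬ q ∣ k <;> simp only [hs, hi, hj, hk] <;> simp
      ring
    · simp only [hs, false_and, if_false]
  rw [e, tripleSum, hI _ (by simp [v0]) (by simp [vn])]
  refine sum_congr rfl fun i _ => ?_
  rw [hI _ (by simp [v0]) (by simp [vn])]
  refine sum_congr rfl fun j _ => ?_
  rw [hI _ (by simp [v0]) (by simp [vn])]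

variable {p : ℕ} [hp : Fact p.Prime]

theorem tripleSum_two_mul_add {q n k : ℕ} (hk : p ^ k ∣ n) (hpn : p ∣ n) (hqn : q ∣ n) :
    PDvd p k (tripleSum p q n (2 * n) + tripleSum p q n n) := by
  set v := invUnit p q with hv
  have v0 : v 0 = 0 := invUnit_of_dvd (dvd_zero p)
  have vn : v n = 0 := invUnit_of_dvd hpn
  have e : tripleSum p q n (2 * n) = ∑ a ∈ range n, ∑ b ∈ range n, ∑ c ∈ range n,
      if a + b + c = n then v (n - a) * v (n - b) * v (n - c) else 0 := by
    rw [tripleSum, ← sum_range_sub_eq (by simp [← hv, v0, vn])]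
    refine sum_congr rfl fun a ha => ?_
    rw [← sum_range_sub_eq (by simp [← hv, v0, vn])]
    refine sum_congr rfl fun b hb => ?_
    rw [← sum_range_sub_eq (by simp [← hv, v0, vn])]
    refine sum_congr rfl fun c hc => ?_
    have := mem_range.1 ha
    have := mem_range.1 hb
    have := mem_range.1 hc
    exact if_congr (by omega) rfl rfl
  rw [e, tripleSum, ← sum_add_distrib]
  refine PDvd.sum _ fun a ha => ?_
  rw [← sum_add_distrib]
  refine PDvd.sum _ fun b hb => ?_
  rw [← sum_add_distrib]
  refine PDvd.sum _ fun c hc => ?_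
  split_ifs
  · have i1 : ∀ x, PDvd p 0 (v x) := invUnit_integral q
    have h : ∀ x ∈ range n, PDvd p k (v (n - x) + v x) := fun x hx =>
      invUnit_sub hk hpn hqn (mem_range.1 hx).le
    have := (((h a ha).mul_right (i1 (n - b))).mul_right (i1 (n - c))).sub
      (((h b hb).mul_right (i1 a)).mul_right (i1 (n - c))) |>.add
      (((h c hc).mul_right (i1 a)).mul_right (i1 b))
    convert this using 1
    ring
  · simpa using PDvd.zero (p := p) k

theorem natCast_mul_Z_add {q n k : ℕ} (h : ∀ x, Nat.Coprime x n ↔ ¬ p ∣ x ∧ ¬ q ∣ x)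
    (hk : p ^ k ∣ n) (hpn : p ∣ n) (hqn : q ∣ n) (hn : 0 < n) :
    PDvd p (k + k) (n * Z n + 3 * pairSum p q n) := by
  have := ((PDvd.natCast 2).mul_left
    ((PDvd.of_dvd hk).mul (tripleSum_two_mul_add (q := q) hk hpn hqn)))
  rw [Z_eq_tripleSum h hpn, ← natCast_mul_tripleSum_add hpn hqn hn]
  convert this using 1
  push_cast
  ring

theorem coprime_pow_mul_pow_iff {q α β : ℕ} (hq : q.Prime) (hα : 0 < α) (hβ : 0 < β) (x : ℕ) :
    Nat.Coprime x (p ^ α * q ^ β) ↔ ¬ p ∣ x ∧ ¬ q ∣ x := by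
  rw [Nat.coprime_mul_iff_right, Nat.coprime_pow_right_iff hα, Nat.coprime_pow_right_iff hβ,
    Nat.coprime_comm, hp.out.coprime_iff_not_dvd, Nat.coprime_comm (n := x),
    hq.coprime_iff_not_dvd]

end

theorem Z_pq_pow_congr (p q : ℕ) (hp : p.Prime) (hq : q.Prime) (hp2 : p ≠ 2) (hq2 : q ≠ 2)
    (hpq : p ≠ q) (α β : ℕ) (hα : 1 ≤ α) (hβ : 1 ≤ β) :
    ratCong (p ^ α) (Z (p ^ α * q ^ β))
      (2 * (2 - (q : ℚ)) * (1 - 1 / (q : ℚ) ^ 3) * (p : ℚ) ^ (α - 1) * (q : ℚ) ^ (β - 1) *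
        bernoulli (p - 3)) := by
  have := Fact.mk hp
  have hcop : Nat.Coprime p q := (Nat.coprime_primes hp hq).2 hpq
  have hpq' : ¬ p ∣ q := (hp.coprime_iff_not_dvd).1 hcop
  have hqβ : ¬ p ∣ q ^ β := fun h => hpq' (hp.dvd_of_dvd_pow h)
  have hcopn := coprime_pow_mul_pow_iff (p := p) hq hα hβ
  obtain ⟨a, rfl⟩ := Nat.exists_eq_add_of_le' hα
  obtain ⟨b, rfl⟩ := Nat.exists_eq_add_of_le' hβ
  simp only [Nat.add_sub_cancel]
  have hn : p ^ (a + 1) * q ^ (b + 1) = p * q * (p ^ a * q ^ b) := by ring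
  have h1 := natCast_mul_Z_add hcopn (Dvd.intro _ rfl)
    (Dvd.dvd.mul_right (dvd_pow_self p (by omega)) _)
    (Dvd.dvd.mul_left (dvd_pow_self q (by omega)) _)
    (Nat.mul_pos (pow_pos hp.pos _) (pow_pos hq.pos _))
  have hN : p ^ a ∣ p ^ a * q ^ b := Dvd.intro _ rfl
  have h2 := three_mul_pairSum_mul hp2 (Dvd.intro q rfl) (Dvd.intro_left p rfl) hN
  have hN2 : PDvd p (2 * a) (((p ^ a * q ^ b : ℕ) : ℚ) ^ 2) := by
    have := (PDvd.of_dvd (p := p) hN).mul (PDvd.of_dvd hN)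
    rwa [← two_mul, ← sq] at this
  have h3 := (PDvd.natCast (p := p) 3).mul_left (hN2.mul (pairSum_base hp2 hcop hq.pos))
  have h4 := ((((PDvd.natCast (p := p) q).mul_left
    ((PDvd.natCast 2).sub (PDvd.natCast q))).mul_left
    ((PDvd.natCast 1).sub ((PDvd.inv hpq').pow 3))).mul_left (hN2.mul (three_mul_reflSum hp2)))
  refine ratCong_of_PDvd (PDvd.cancel hqβ (PDvd.cancel_pow (j := a + 1) ?_))
  rw [show a + 1 + (a + 1) = 2 * a + 2 by ring] at h1 ⊢
  have := h1.sub (h2.add (h3.add h4))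
  convert this using 1
  rw [hn]
  push_cast
  rw [one_div_pow]
  generalize 1 - 1 / (q : ℚ) ^ 3 = w
  ring
end
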